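/- arXiv:math/0611708 — 3 statements merged into one kernel-verified Lean document; each statement's English description precedes it below -/
import Mathlib

section
/- Let r ≥ 1 and for each ν ∈ {1,…,r} and n ∈ ℕ let A^{(ν,n)} be a real n×n matrix. Assume that for all μ,ν ∈ {1,…,r} the limit c_{μν} := lim_{n→∞} (1/n)·Tr(A^{(μ,n)}(A^{(ν,n)})ᵀ) exists, and that c_{νν} > 0 for each ν. Let g^{(n)} be a Haar-distributed random element of O(n). Then, as n → ∞, the random vector (Tr(A^{(1,n)}g^{(n)}), …, Tr(A^{(r,n)}g^{(n)})) converges in distribution to the centered Gaussian distribution on ℝ^r with covariance matrix (c_{μν}). -/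
open MeasureTheory ProbabilityTheory Matrix Filter Topology

/-- Matrices inherit the product measurable structure. -/
instance matrixMeasurableSpace {m n α : Type*} [MeasurableSpace α] :
    MeasurableSpace (Matrix m n α) :=
  inferInstanceAs (MeasurableSpace (m → n → α))

/-- `γ` is the Gaussian distribution on `ℝ^r` with mean vector `m` and covariance
matrix `C`, characterized via its one-dimensional linear projections (Cramér–Wold). -/
def IsGaussianMeasure {r : ℕ} (γ : Measure (Fin r → ℝ)) (m : Fin r → ℝ)
    (C : Matrix (Fin r) (Fin r) ℝ) : Prop :=
  IsProbabilityMeasure γ ∧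
    ∀ t : Fin r → ℝ,
      γ.map (fun x => ∑ i, t i * x i) =
        gaussianReal (∑ i, t i * m i)
          (Real.toNNReal (∑ i, ∑ j, t i * C i j * t j))


/-! ### Part 1: integration by parts on the orthogonal group -/

open scoped Matrix.Norms.Operator in
theorem og_borel (n : ℕ) : BorelSpace (Matrix.orthogonalGroup (Fin n) ℝ) := by
  have : BorelSpace (Matrix (Fin n) (Fin n) ℝ) :=
    inferInstanceAs (BorelSpace (Fin n → Fin n → ℝ))
  exact Subtype.borelSpace _

theorem og_bound {n : ℕ} {E : Type*} [NormedAddCommGroup E]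
    (B : Matrix (Fin n) (Fin n) ℝ) (G : Matrix (Fin n) (Fin n) ℝ → E) (hG : Continuous G) :
    ∃ C, ∀ g : Matrix.orthogonalGroup (Fin n) ℝ,
      ‖G ((g : Matrix (Fin n) (Fin n) ℝ) * B)‖ ≤ C := by
  have hK : IsCompact (Set.univ.pi fun _ : Fin n => Set.univ.pi fun _ : Fin n =>
      Set.Icc (-1 : ℝ) 1) :=
    isCompact_univ_pi fun _ => isCompact_univ_pi fun _ => isCompact_Icc
  have hc : Continuous fun X : Matrix (Fin n) (Fin n) ℝ => G (X * B) := by fun_prop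
  obtain ⟨C, hC⟩ := hK.exists_bound_of_continuousOn (f := fun X => G (Matrix.of X * B))
    hc.continuousOn
  refine ⟨C, fun g => hC (g : Matrix (Fin n) (Fin n) ℝ) ?_⟩
  intro i _ j _
  have := entry_norm_bound_of_unitary (𝕜 := ℝ) g.2 i j
  rw [Real.norm_eq_abs, abs_le] at this
  exact this

theorem og_integrable {n : ℕ} {E : Type*} [NormedAddCommGroup E]
    [SecondCountableTopology E]
    (ν : Measure (Matrix.orthogonalGroup (Fin n) ℝ)) [IsProbabilityMeasure ν]
    (B : Matrix (Fin n) (Fin n) ℝ) (G : Matrix (Fin n) (Fin n) ℝ → E) (hG : Continuous G) :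
    Integrable (fun g : Matrix.orthogonalGroup (Fin n) ℝ =>
      G ((g : Matrix (Fin n) (Fin n) ℝ) * B)) ν := by
  have := og_borel n
  obtain ⟨C, hC⟩ := og_bound B G hG
  refine Integrable.of_bound (Continuous.aestronglyMeasurable ?_) C (ae_of_all _ hC)
  fun_prop

open scoped Matrix.Norms.Operator in
theorem og_ibp {n : ℕ} {E : Type*} [NormedAddCommGroup E] [NormedSpace ℝ E] [CompleteSpace E]
    [SecondCountableTopology E]
    (ν : Measure (Matrix.orthogonalGroup (Fin n) ℝ)) [IsProbabilityMeasure ν]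
    [ν.IsMulLeftInvariant]
    (B L : Matrix (Fin n) (Fin n) ℝ) (hL : Lᵀ = -L)
    (F G : Matrix (Fin n) (Fin n) ℝ → E) (hF : Continuous F) (hG : Continuous G)
    (hFG : ∀ (c : ℝ → Matrix (Fin n) (Fin n) ℝ) (θ : ℝ), HasDerivAt c (L * c θ) θ →
      HasDerivAt (fun s => F (c s)) (G (c θ)) θ) :
    ∫ g, G ((g : Matrix (Fin n) (Fin n) ℝ) * B) ∂ν = 0 := by
  have := og_borel n
  have hmem : ∀ θ : ℝ, NormedSpace.exp (θ • L) ∈ Matrix.orthogonalGroup (Fin n) ℝ := by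
    intro θ
    rw [Matrix.mem_orthogonalGroup_iff,
      ← Matrix.exp_transpose,
      Matrix.transpose_smul, hL, smul_neg, Matrix.exp_neg]
    exact Matrix.mul_nonsing_inv _ ((Matrix.isUnit_iff_isUnit_det _).1 (Matrix.isUnit_exp _))
  let R : ℝ → Matrix.orthogonalGroup (Fin n) ℝ := fun θ => ⟨_, hmem θ⟩
  obtain ⟨C, hC⟩ := og_bound B G hG
  have hconst : ∀ θ, ∫ g, F ((R θ * g : Matrix.orthogonalGroup (Fin n) ℝ) * B) ∂ν
      = ∫ g, F ((g : Matrix (Fin n) (Fin n) ℝ) * B) ∂ν := by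
    intro θ
    exact integral_mul_left_eq_self
      (fun g : Matrix.orthogonalGroup (Fin n) ℝ => F ((g : Matrix (Fin n) (Fin n) ℝ) * B)) (R θ)
  have hcurve : ∀ (g : Matrix.orthogonalGroup (Fin n) ℝ) (θ : ℝ),
      HasDerivAt (fun s => ((R s * g : Matrix.orthogonalGroup (Fin n) ℝ) : Matrix _ _ ℝ) * B)
        (L * (((R θ * g : Matrix.orthogonalGroup (Fin n) ℝ) : Matrix _ _ ℝ) * B)) θ := by
    intro g θ
    have h := ((hasDerivAt_exp_smul_const' (𝕂 := ℝ) L θ).mul_const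
      (g : Matrix (Fin n) (Fin n) ℝ)).mul_const B
    simp only [Matrix.mul_assoc] at h
    simp only [R, Submonoid.coe_mul, Matrix.mul_assoc]
    exact h
  have hd := (hasDerivAt_integral_of_dominated_loc_of_deriv_le (μ := ν) (𝕜 := ℝ)
    (F := fun θ g => F ((R θ * g : Matrix.orthogonalGroup (Fin n) ℝ) * B))
    (F' := fun θ g => G ((R θ * g : Matrix.orthogonalGroup (Fin n) ℝ) * B))
    (bound := fun _ => C) (x₀ := (0 : ℝ)) (s := Set.univ) univ_mem
    (Eventually.of_forall fun θ => Continuous.aestronglyMeasurable (by simp; fun_prop))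
    (by
      have := og_integrable ν B (fun X => F ((R 0 : Matrix _ _ ℝ) * X)) (by fun_prop)
      simpa [Matrix.mul_assoc] using this)
    (Continuous.aestronglyMeasurable (by simp; fun_prop))
    (ae_of_all _ fun g θ _ => hC _)
    (integrable_const _)
    (ae_of_all _ fun g θ _ => hFG _ θ (hcurve g θ))).2
  have hd0 : HasDerivAt (fun θ => ∫ g, F ((R θ * g : Matrix.orthogonalGroup (Fin n) ℝ) * B) ∂ν)
      0 0 := by
    simp_rw [hconst]
    exact hasDerivAt_const _ _
  have := hd.unique hd0
  have hR0 : R 0 = 1 := by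
    ext1
    simp [R]
  simpa [hR0] using this

/-! ### Part 2: trace identities -/

open scoped Matrix.Norms.Operator in
theorem hasDerivAt_tr {n : ℕ} (A : Matrix (Fin n) (Fin n) ℝ) (c : ℝ → Matrix (Fin n) (Fin n) ℝ)
    (c' : Matrix (Fin n) (Fin n) ℝ) (θ : ℝ) (hc : HasDerivAt c c' θ) :
    HasDerivAt (fun s => (A * c s).trace) ((A * c').trace) θ := by
  let T : Matrix (Fin n) (Fin n) ℝ →L[ℝ] ℝ :=
    (Matrix.traceLinearMap (Fin n) ℝ ℝ ∘ₗ LinearMap.mulLeft ℝ A).toContinuousLinearMap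
  exact T.hasFDerivAt.comp_hasDerivAt θ hc

open scoped Matrix.Norms.Operator in
theorem hasDerivAt_sq {n : ℕ} (c : ℝ → Matrix (Fin n) (Fin n) ℝ)
    (c' : Matrix (Fin n) (Fin n) ℝ) (θ : ℝ) (hc : HasDerivAt c c' θ) :
    HasDerivAt (fun s => c s * c s) (c' * c θ + c θ * c') θ := by
  exact HasDerivAt.mul (𝕜 := ℝ) (𝔸 := Matrix (Fin n) (Fin n) ℝ) hc hc

/-- The elementary skew-symmetric matrices. -/
def skewE {n : ℕ} (i j : Fin n) : Matrix (Fin n) (Fin n) ℝ :=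
  Matrix.single i j 1 - Matrix.single j i 1

theorem skewE_transpose {n : ℕ} (i j : Fin n) : (skewE i j)ᵀ = -skewE i j := by
  simp [skewE]

theorem tr_skewE {n : ℕ} (i j : Fin n) (X : Matrix (Fin n) (Fin n) ℝ) :
    (skewE i j * X).trace = X j i - X i j := by
  simp [skewE, sub_mul, Matrix.trace_single_mul]

theorem tr_single2 {n : ℕ} (i j k l : Fin n) (X Y : Matrix (Fin n) (Fin n) ℝ) :
    (Matrix.single i j 1 * (X * (Matrix.single k l 1 * Y))).trace = X j k * Y l i := by
  rw [Matrix.trace_single_mul, Matrix.mul_apply]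
  rw [Finset.sum_eq_single k]
  · simp
  · intro b _ hb
    rw [Matrix.single_mul_apply_of_ne _ _ _ _ _ hb, mul_zero]
  · simp

theorem sum_skewE_two {n : ℕ} (X Y : Matrix (Fin n) (Fin n) ℝ) :
    ∑ i, ∑ j, (skewE i j * (X * (skewE i j * Y))).trace
      = 2 * ((Xᵀ * Y).trace - X.trace * Y.trace) := by
  have h : ∀ i j : Fin n, (skewE i j * (X * (skewE i j * Y))).trace
      = X j i * Y j i - X j j * Y i i - X i i * Y j j + X i j * Y i j := by
    intro i j
    simp only [skewE, sub_mul, mul_sub, Matrix.trace_sub, tr_single2]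
    ring
  simp_rw [h, Finset.sum_add_distrib, Finset.sum_sub_distrib]
  have h1 : ∑ i, ∑ j, X j i * Y j i = (Xᵀ * Y).trace := by
    simp [Matrix.trace, Matrix.mul_apply]
  have h2 : ∑ i, ∑ j, X i j * Y i j = (Xᵀ * Y).trace := by
    rw [Finset.sum_comm, h1]
  have h3 : ∑ i, ∑ j, X i i * Y j j = X.trace * Y.trace := by
    simp [Matrix.trace, Finset.sum_mul_sum]
  have h4 : ∑ i, ∑ j, X j j * Y i i = X.trace * Y.trace := by
    rw [Finset.sum_comm, h3]
  rw [h1, h2, h3, h4]; ring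

theorem sum_skewE_one {n : ℕ} (X : Matrix (Fin n) (Fin n) ℝ) :
    ∑ i, ∑ j, (skewE i j * (skewE i j * X)).trace = -(2 * ((n : ℝ) - 1) * X.trace) := by
  have := sum_skewE_two (1 : Matrix (Fin n) (Fin n) ℝ) X
  simp only [one_mul, Matrix.transpose_one, Matrix.trace_one, Fintype.card_fin] at this
  rw [this]; ring

theorem sum_skewE_sq {n : ℕ} (X : Matrix (Fin n) (Fin n) ℝ) :
    ∑ i, ∑ j, (skewE i j * X).trace ^ 2 = 2 * ((Xᵀ * X).trace - (X * X).trace) := by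
  have h : ∀ i j : Fin n, (skewE i j * X).trace ^ 2
      = X j i * X j i - 2 * (X i j * X j i) + X i j * X i j := by
    intro i j
    rw [tr_skewE]; ring
  simp_rw [h, Finset.sum_add_distrib, Finset.sum_sub_distrib, ← Finset.mul_sum]
  have h1 : ∑ i, ∑ j, X j i * X j i = (Xᵀ * X).trace := by
    simp [Matrix.trace, Matrix.mul_apply]
  have h2 : ∑ i, ∑ j, X i j * X i j = (Xᵀ * X).trace := by
    rw [Finset.sum_comm, h1]
  have h3 : ∑ i, ∑ j, X i j * X j i = (X * X).trace := by
    simp [Matrix.trace, Matrix.mul_apply]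
  rw [h1, h2, h3]; ring

theorem tr_sq_eq {n : ℕ} (X : Matrix (Fin n) (Fin n) ℝ) :
    (Xᵀ * X).trace = ∑ i, ∑ j, X i j ^ 2 := by
  rw [Finset.sum_comm]
  simp [Matrix.trace, Matrix.mul_apply, sq]

theorem tr_sq_nonneg {n : ℕ} (X : Matrix (Fin n) (Fin n) ℝ) : 0 ≤ (Xᵀ * X).trace := by
  rw [tr_sq_eq]; positivity

theorem abs_tr_mul_self_le {n : ℕ} (X : Matrix (Fin n) (Fin n) ℝ) :
    |(X * X).trace| ≤ (Xᵀ * X).trace := by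
  have h1 := sum_skewE_sq X
  have h2 : 0 ≤ ∑ i, ∑ j, (skewE i j * X).trace ^ 2 := by positivity
  have h3 : ∑ i, ∑ j, (X i j + X j i) ^ 2 = 2 * ((Xᵀ * X).trace + (X * X).trace) := by
    have h : ∀ i j : Fin n, (X i j + X j i) ^ 2
      = (X j i - X i j) ^ 2 + 4 * (X i j * X j i) := by
      intro i j
      ring
    simp_rw [h, Finset.sum_add_distrib, ← tr_skewE, h1, ← Finset.mul_sum]
    have h3 : ∑ i, ∑ j, X i j * X j i = (X * X).trace := by
      simp [Matrix.trace, Matrix.mul_apply]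
    rw [h3]; ring
  have h4 : 0 ≤ ∑ i, ∑ j, (X i j + X j i) ^ 2 := by positivity
  rw [abs_le]
  constructor <;> linarith

theorem tr_sq_sq_le {n : ℕ} (X : Matrix (Fin n) (Fin n) ℝ) :
    ((X * X)ᵀ * (X * X)).trace ≤ (Xᵀ * X).trace ^ 2 := by
  rw [tr_sq_eq, tr_sq_eq, sq (∑ i, ∑ j, X i j ^ 2)]
  nth_rewrite 3 [Finset.sum_comm]
  rw [Finset.sum_mul_sum]
  refine Finset.sum_le_sum fun i _ => Finset.sum_le_sum fun j _ => ?_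
  rw [Matrix.mul_apply]
  exact Finset.sum_mul_sq_le_sq_mul_sq _ _ _

theorem og_tr {n : ℕ} (B : Matrix (Fin n) (Fin n) ℝ) (g : Matrix.orthogonalGroup (Fin n) ℝ) :
    (((g : Matrix (Fin n) (Fin n) ℝ) * B)ᵀ * ((g : Matrix (Fin n) (Fin n) ℝ) * B)).trace
      = (Bᵀ * B).trace := by
  have h := (Matrix.mem_orthogonalGroup_iff' (Fin n) ℝ).1 g.2
  rw [Matrix.transpose_mul, Matrix.mul_assoc, ← Matrix.mul_assoc _ _ B, h, Matrix.one_mul]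

section identities

variable {n : ℕ} (ν : Measure (Matrix.orthogonalGroup (Fin n) ℝ)) [IsProbabilityMeasure ν]
    [ν.IsMulLeftInvariant] (B : Matrix (Fin n) (Fin n) ℝ)

/-- Summed form of the integration by parts. -/
theorem og_sum {E : Type*} [NormedAddCommGroup E] [NormedSpace ℝ E] [CompleteSpace E]
    [SecondCountableTopology E]
    (F G : Fin n → Fin n → Matrix (Fin n) (Fin n) ℝ → E) (hF : ∀ i j, Continuous (F i j))
    (hG : ∀ i j, Continuous (G i j))
    (hFG : ∀ i j (c : ℝ → Matrix (Fin n) (Fin n) ℝ) (θ : ℝ),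
      HasDerivAt c (skewE i j * c θ) θ →
      HasDerivAt (fun s => F i j (c s)) (G i j (c θ)) θ) :
    ∫ g, ∑ i, ∑ j, G i j ((g : Matrix (Fin n) (Fin n) ℝ) * B) ∂ν = 0 := by
  rw [integral_finsetSum _ fun i _ => integrable_finsetSum _ fun j _ =>
    og_integrable ν B _ (hG i j)]
  refine Finset.sum_eq_zero fun i _ => ?_
  rw [integral_finsetSum _ fun j _ => og_integrable ν B _ (hG i j)]
  exact Finset.sum_eq_zero fun j _ =>
    og_ibp ν B (skewE i j) (skewE_transpose i j) _ _ (hF i j) (hG i j) (hFG i j)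

theorem idA : ∫ g : Matrix.orthogonalGroup (Fin n) ℝ,
      (-(2 * ((n : ℝ) - 1) * ((g : Matrix (Fin n) (Fin n) ℝ) * B).trace ^ 2)
       + 2 * ((Bᵀ * B).trace - (((g : Matrix (Fin n) (Fin n) ℝ) * B) *
        ((g : Matrix (Fin n) (Fin n) ℝ) * B)).trace)) ∂ν = 0 := by
  rw [← og_sum ν B (fun i j X => (skewE i j * X).trace * X.trace)
    (fun i j X => (skewE i j * (skewE i j * X)).trace * X.trace + (skewE i j * X).trace ^ 2)
    (fun i j => by fun_prop) (fun i j => by fun_prop)]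
  · congr 1
    ext g
    simp_rw [Finset.sum_add_distrib, ← Finset.sum_mul, sum_skewE_one, sum_skewE_sq, og_tr]
    ring
  · intro i j c θ hc
    have h1 := hasDerivAt_tr (skewE i j) c _ θ hc
    have h2 := hasDerivAt_tr 1 c _ θ hc
    simp only [one_mul] at h2
    convert! h1.mul h2 using 1
    ring

theorem idB : ∫ g : Matrix.orthogonalGroup (Fin n) ℝ,
      (fun X : Matrix (Fin n) (Fin n) ℝ => -(2 * ((n : ℝ) - 1) * (X * X).trace ^ 2)
       + 2 * ((Bᵀ * B).trace - X.trace ^ 2) * (X * X).trace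
       + 4 * (((X * X)ᵀ * (X * X)).trace - ((X * X) * (X * X)).trace))
        ((g : Matrix (Fin n) (Fin n) ℝ) * B) ∂ν = 0 := by
  rw [← og_sum ν B (fun i j X => (skewE i j * (X * X)).trace * (X * X).trace)
    (fun i j X => ((skewE i j * (skewE i j * (X * X))).trace +
        (skewE i j * (X * (skewE i j * X))).trace) * (X * X).trace
        + 2 * (skewE i j * (X * X)).trace ^ 2)
    (fun i j => by fun_prop) (fun i j => by fun_prop)]
  · congr 1
    ext g
    simp_rw [Finset.sum_add_distrib, ← Finset.mul_sum, ← Finset.sum_mul, Finset.sum_add_distrib,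
      sum_skewE_one, sum_skewE_two, sum_skewE_sq, og_tr]
    ring
  · intro i j c θ hc
    have h0 := hasDerivAt_sq c _ θ hc
    have h1 := hasDerivAt_tr (skewE i j) _ _ θ h0
    have h2 := hasDerivAt_tr 1 _ _ θ h0
    simp only [one_mul] at h2
    convert! h1.mul h2 using 1
    have e1 : (c θ * (skewE i j * c θ)).trace = (skewE i j * (c θ * c θ)).trace := by
      rw [Matrix.trace_mul_comm, Matrix.mul_assoc]
    simp only [Matrix.mul_add, Matrix.trace_add, Matrix.mul_assoc, e1]
    ring

theorem idC (s : ℝ) : ∫ g : Matrix.orthogonalGroup (Fin n) ℝ,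
      (fun X : Matrix (Fin n) (Fin n) ℝ =>
       (-(2 * ((n : ℂ) - 1) * X.trace)
       + 2 * (s * Complex.I) * (((Bᵀ * B).trace : ℂ) - (X * X).trace)) *
        Complex.exp (s * X.trace * Complex.I))
        ((g : Matrix (Fin n) (Fin n) ℝ) * B) ∂ν = 0 := by
  rw [← og_sum ν B (fun i j X => (((skewE i j * X).trace : ℝ) : ℂ) *
      Complex.exp (s * X.trace * Complex.I))
    (fun i j X => ((((skewE i j * (skewE i j * X)).trace : ℝ) : ℂ) +
        (s * Complex.I) * (((skewE i j * X).trace ^ 2 : ℝ) : ℂ)) *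
      Complex.exp (s * X.trace * Complex.I))
    (fun i j => by fun_prop) (fun i j => by fun_prop)]
  · congr 1
    ext g
    simp_rw [← Finset.sum_mul, Finset.sum_add_distrib, ← Finset.mul_sum, ← Complex.ofReal_sum,
      sum_skewE_one, sum_skewE_sq, og_tr]
    push_cast
    ring
  · intro i j c θ hc
    have h1 := (hasDerivAt_tr (skewE i j) c _ θ hc).ofReal_comp
    have h2 := (hasDerivAt_tr 1 c _ θ hc).ofReal_comp
    simp only [one_mul] at h2
    convert! h1.mul (((h2.const_mul (s : ℂ)).mul_const Complex.I).cexp) using 1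
    push_cast
    ring

end identities

/-! ### Part 3: estimates -/

section estimates

variable {n : ℕ} (ν : Measure (Matrix.orthogonalGroup (Fin n) ℝ)) [IsProbabilityMeasure ν]
    [ν.IsMulLeftInvariant] (B : Matrix (Fin n) (Fin n) ℝ)

theorem og_abs_P_le (g : Matrix.orthogonalGroup (Fin n) ℝ) :
    |(((g : Matrix (Fin n) (Fin n) ℝ) * B) * ((g : Matrix (Fin n) (Fin n) ℝ) * B)).trace|
      ≤ (Bᵀ * B).trace := by
  have := abs_tr_mul_self_le ((g : Matrix (Fin n) (Fin n) ℝ) * B)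
  rwa [og_tr] at this

theorem estW : ((n : ℝ) - 1) * ∫ g : Matrix.orthogonalGroup (Fin n) ℝ,
      ((g : Matrix (Fin n) (Fin n) ℝ) * B).trace ^ 2 ∂ν ≤ 2 * (Bᵀ * B).trace := by
  have h := idA ν B
  have i1 := og_integrable ν B (fun X => X.trace ^ 2) (by fun_prop)
  have i2 := og_integrable ν B (fun X => (X * X).trace) (by fun_prop)
  have i3 := og_integrable ν B (fun X => (Bᵀ * B).trace - (X * X).trace) (by fun_prop)
  rw [integral_add (i1.const_mul _).fun_neg (i3.const_mul _),
    integral_neg, integral_const_mul, integral_const_mul,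
    integral_sub (integrable_const _) i2] at h
  have hP : -(Bᵀ * B).trace ≤ ∫ g : Matrix.orthogonalGroup (Fin n) ℝ,
      (((g : Matrix (Fin n) (Fin n) ℝ) * B) * ((g : Matrix (Fin n) (Fin n) ℝ) * B)).trace ∂ν := by
    have := integral_mono (μ := ν) (integrable_const (-(Bᵀ * B).trace)) i2
      (fun g => (abs_le.1 (og_abs_P_le B g)).1)
    simpa using this
  simp only [integral_const, probReal_univ, one_smul] at h
  linarith

theorem estP (hn : 2 ≤ n) : ((n : ℝ) - 1) * ∫ g : Matrix.orthogonalGroup (Fin n) ℝ,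
      (((g : Matrix (Fin n) (Fin n) ℝ) * B) *
        ((g : Matrix (Fin n) (Fin n) ℝ) * B)).trace ^ 2 ∂ν ≤ 7 * (Bᵀ * B).trace ^ 2 := by
  have h := idB ν B
  have hn' : (1 : ℝ) ≤ (n : ℝ) - 1 := by
    have : (2 : ℝ) ≤ n := by exact_mod_cast hn
    linarith
  have hN := tr_sq_nonneg B
  have i1 := og_integrable ν B (fun X => X.trace ^ 2) (by fun_prop)
  have i2 := og_integrable ν B (fun X => (X * X).trace ^ 2) (by fun_prop)
  have i3 := og_integrable ν B (fun X => 2 * ((Bᵀ * B).trace - X.trace ^ 2) * (X * X).trace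
       + 4 * (((X * X)ᵀ * (X * X)).trace - ((X * X) * (X * X)).trace)) (by fun_prop)
  simp only [add_assoc] at h
  rw [integral_add (i2.const_mul _).fun_neg i3, integral_neg, integral_const_mul] at h
  have hb := integral_mono (μ := ν) i3 ((i1.const_mul (2 * (Bᵀ * B).trace)).add
    (integrable_const (10 * (Bᵀ * B).trace ^ 2))) (by
      intro g
      simp only [Pi.add_apply]
      have a1 := abs_le.1 (og_abs_P_le B g)
      have a2 := og_tr B g
      generalize (g : Matrix (Fin n) (Fin n) ℝ) * B = X at a1 a2 ⊢
      have a3 := abs_le.1 (abs_tr_mul_self_le (X * X))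
      have a4 := tr_sq_sq_le X
      rw [a2] at a4
      have a5 := sq_nonneg X.trace
      generalize (Bᵀ * B).trace = N at *
      nlinarith [mul_nonneg hN (sub_nonneg.2 a1.2), mul_nonneg a5 (sub_nonneg.2 a1.1)])
  rw [integral_add' (i1.const_mul _) (integrable_const _), integral_const_mul] at hb
  simp only [integral_const, probReal_univ, one_smul] at hb
  have hw := estW ν B
  have hw0 : 0 ≤ ∫ g : Matrix.orthogonalGroup (Fin n) ℝ,
      ((g : Matrix (Fin n) (Fin n) ℝ) * B).trace ^ 2 ∂ν := integral_nonneg fun g => sq_nonneg _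
  generalize (∫ g : Matrix.orthogonalGroup (Fin n) ℝ,
      ((g : Matrix (Fin n) (Fin n) ℝ) * B).trace ^ 2 ∂ν) = w at *
  have hw1 : w ≤ 2 * (Bᵀ * B).trace := by nlinarith
  nlinarith

theorem estAbsP (hn : 2 ≤ n) : ∫ g : Matrix.orthogonalGroup (Fin n) ℝ,
      |(((g : Matrix (Fin n) (Fin n) ℝ) * B) *
        ((g : Matrix (Fin n) (Fin n) ℝ) * B)).trace| ∂ν ≤
        √(7 * (Bᵀ * B).trace ^ 2 / ((n : ℝ) - 1)) := by
  have hn' : (0 : ℝ) < (n : ℝ) - 1 := by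
    have : (2 : ℝ) ≤ n := by exact_mod_cast hn
    linarith
  apply Real.le_sqrt_of_sq_le
  rw [le_div_iff₀ hn', mul_comm]
  refine le_trans ?_ (estP ν B hn)
  refine mul_le_mul_of_nonneg_left ?_ hn'.le
  have i1 := og_integrable ν B (fun X => |(X * X).trace|) (by fun_prop)
  have i2 := og_integrable ν B (fun X => (X * X).trace ^ 2) (by fun_prop)
  set m := ∫ g : Matrix.orthogonalGroup (Fin n) ℝ,
      |(((g : Matrix (Fin n) (Fin n) ℝ) * B) *
        ((g : Matrix (Fin n) (Fin n) ℝ) * B)).trace| ∂ν with hm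
  have h := integral_mono (μ := ν) ((i1.const_mul (2 * m)).sub (integrable_const (m ^ 2))) i2 (by
    intro g
    simp only [Pi.sub_apply]
    rw [← sq_abs (Matrix.trace _)]
    nlinarith [sq_nonneg (|(((g : Matrix (Fin n) (Fin n) ℝ) * B) *
        ((g : Matrix (Fin n) (Fin n) ℝ) * B)).trace| - m)])
  rw [integral_sub' (i1.const_mul _) (integrable_const _), integral_const_mul, ← hm] at h
  simp only [integral_const, probReal_univ, one_smul] at h
  linarith

theorem hasDerivAt_phi (s : ℝ) : HasDerivAt (fun s : ℝ =>
      ∫ g : Matrix.orthogonalGroup (Fin n) ℝ, (fun X : Matrix (Fin n) (Fin n) ℝ =>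
        Complex.exp (s * X.trace * Complex.I)) ((g : Matrix (Fin n) (Fin n) ℝ) * B) ∂ν)
      (∫ g : Matrix.orthogonalGroup (Fin n) ℝ, (fun X : Matrix (Fin n) (Fin n) ℝ =>
        X.trace * Complex.I * Complex.exp (s * X.trace * Complex.I))
          ((g : Matrix (Fin n) (Fin n) ℝ) * B) ∂ν) s := by
  obtain ⟨C, hC⟩ := og_bound B (fun X => X.trace) (by fun_prop)
  refine (hasDerivAt_integral_of_dominated_loc_of_deriv_le (μ := ν) (𝕜 := ℝ)
    (bound := fun _ => C) (x₀ := s) (s := Set.univ) univ_mem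
    (Eventually.of_forall fun θ => (og_integrable ν B (fun X : Matrix (Fin n) (Fin n) ℝ =>
        Complex.exp (θ * X.trace * Complex.I)) (by fun_prop)).aestronglyMeasurable)
    (og_integrable ν B (fun X : Matrix (Fin n) (Fin n) ℝ =>
        Complex.exp (s * X.trace * Complex.I)) (by fun_prop))
    (F' := fun θ g => (fun X : Matrix (Fin n) (Fin n) ℝ =>
        X.trace * Complex.I * Complex.exp (θ * X.trace * Complex.I))
          ((g : Matrix (Fin n) (Fin n) ℝ) * B))
    (og_integrable ν B (fun X : Matrix (Fin n) (Fin n) ℝ =>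
        X.trace * Complex.I * Complex.exp (s * X.trace * Complex.I))
         (by fun_prop)).aestronglyMeasurable
    (ae_of_all _ fun g θ _ => ?_)
    (integrable_const _)
    (ae_of_all _ fun g θ _ => ?_)).2
  · have := hC g
    simp only [norm_mul, Complex.norm_I, mul_one, Complex.norm_real, ← Complex.ofReal_mul,
      Complex.norm_exp_ofReal_mul_I]
    exact this
  · have h1 := (((hasDerivAt_id θ).ofReal_comp.mul_const
      (((g : Matrix (Fin n) (Fin n) ℝ) * B).trace : ℂ)).mul_const Complex.I).cexp
    convert! h1 using 1
    simp
    ring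

theorem deriv_phi_eq (hn : 2 ≤ n) (s : ℝ) :
    (∫ g : Matrix.orthogonalGroup (Fin n) ℝ, (fun X : Matrix (Fin n) (Fin n) ℝ =>
        X.trace * Complex.I * Complex.exp (s * X.trace * Complex.I))
          ((g : Matrix (Fin n) (Fin n) ℝ) * B) ∂ν)
    = -(s * ((Bᵀ * B).trace / ((n : ℂ) - 1))) *
      (∫ g : Matrix.orthogonalGroup (Fin n) ℝ, (fun X : Matrix (Fin n) (Fin n) ℝ =>
        Complex.exp (s * X.trace * Complex.I)) ((g : Matrix (Fin n) (Fin n) ℝ) * B) ∂ν)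
      + s / ((n : ℂ) - 1) *
      ∫ g : Matrix.orthogonalGroup (Fin n) ℝ, (fun X : Matrix (Fin n) (Fin n) ℝ =>
        (X * X).trace * Complex.exp (s * X.trace * Complex.I))
          ((g : Matrix (Fin n) (Fin n) ℝ) * B) ∂ν := by
  have hn' : ((n : ℂ) - 1) ≠ 0 := by
    have h2 : (n : ℂ) ≠ (1 : ℕ) := by
      exact_mod_cast (by omega : n ≠ 1)
    rw [sub_ne_zero]
    simpa using h2
  have h := idC ν B s
  have i1 := og_integrable ν B (fun X : Matrix (Fin n) (Fin n) ℝ =>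
        X.trace * Complex.I * Complex.exp (s * X.trace * Complex.I)) (by fun_prop)
  have i2 := og_integrable ν B (fun X : Matrix (Fin n) (Fin n) ℝ =>
        Complex.exp (s * X.trace * Complex.I)) (by fun_prop)
  have i3 := og_integrable ν B (fun X : Matrix (Fin n) (Fin n) ℝ =>
        (X * X).trace * Complex.exp (s * X.trace * Complex.I)) (by fun_prop)
  have h2 : ∫ g : Matrix.orthogonalGroup (Fin n) ℝ,
      (((2 * ((n : ℂ) - 1) * Complex.I) * (fun X : Matrix (Fin n) (Fin n) ℝ =>
        X.trace * Complex.I * Complex.exp (s * X.trace * Complex.I))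
          ((g : Matrix (Fin n) (Fin n) ℝ) * B)
      + (2 * (s * Complex.I) * ((Bᵀ * B).trace : ℂ)) * (fun X : Matrix (Fin n) (Fin n) ℝ =>
        Complex.exp (s * X.trace * Complex.I)) ((g : Matrix (Fin n) (Fin n) ℝ) * B))
      - (2 * (s * Complex.I)) * (fun X : Matrix (Fin n) (Fin n) ℝ =>
        (X * X).trace * Complex.exp (s * X.trace * Complex.I))
          ((g : Matrix (Fin n) (Fin n) ℝ) * B)) ∂ν = 0 := by
    rw [← h]
    congr 1
    ext g
    have := Complex.I_mul_I
    linear_combination (2 * ((n : ℂ) - 1) * (((g : Matrix (Fin n) (Fin n) ℝ) * B).trace : ℂ) *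
      Complex.exp (s * ((g : Matrix (Fin n) (Fin n) ℝ) * B).trace * Complex.I)) * this
  rw [integral_sub ((i1.const_mul _).fun_add (i2.const_mul _)) (i3.const_mul _),
    integral_add (i1.const_mul _) (i2.const_mul _), integral_const_mul, integral_const_mul,
    integral_const_mul] at h2
  beta_reduce
  generalize (∫ g : Matrix.orthogonalGroup (Fin n) ℝ,
    (((g : Matrix (Fin n) (Fin n) ℝ) * B).trace : ℂ) * Complex.I *
      Complex.exp (s * ((g : Matrix (Fin n) (Fin n) ℝ) * B).trace * Complex.I) ∂ν) = a1 at h2 ⊢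
  generalize (∫ g : Matrix.orthogonalGroup (Fin n) ℝ,
      Complex.exp (s * ((g : Matrix (Fin n) (Fin n) ℝ) * B).trace * Complex.I) ∂ν) = a2 at h2 ⊢
  generalize (∫ g : Matrix.orthogonalGroup (Fin n) ℝ,
    ((((g : Matrix (Fin n) (Fin n) ℝ) * B) * ((g : Matrix (Fin n) (Fin n) ℝ) * B)).trace : ℂ) *
      Complex.exp (s * ((g : Matrix (Fin n) (Fin n) ℝ) * B).trace * Complex.I) ∂ν) = a3 at h2 ⊢
  field_simp
  have hI : (2 * Complex.I) ≠ 0 := by simp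
  apply mul_left_cancel₀ hI
  linear_combination h2

theorem phi_bound (hn : 2 ≤ n) :
    ‖(∫ g : Matrix.orthogonalGroup (Fin n) ℝ,
        Complex.exp (((g : Matrix (Fin n) (Fin n) ℝ) * B).trace * Complex.I) ∂ν)
      - Complex.exp (-(((Bᵀ * B).trace / ((n : ℝ) - 1) / 2 : ℝ) : ℂ))‖
      ≤ √(7 * (Bᵀ * B).trace ^ 2 / ((n : ℝ) - 1)) / ((n : ℝ) - 1) := by
  have hn' : (0 : ℝ) < (n : ℝ) - 1 := by
    have : (2 : ℝ) ≤ n := by exact_mod_cast hn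
    linarith
  set v : ℝ := (Bᵀ * B).trace / ((n : ℝ) - 1) with hv
  have hv0 : 0 ≤ v := div_nonneg (tr_sq_nonneg B) hn'.le
  set ε : ℝ := √(7 * (Bᵀ * B).trace ^ 2 / ((n : ℝ) - 1)) / ((n : ℝ) - 1) with hε
  set φ : ℝ → ℂ := fun s => ∫ g : Matrix.orthogonalGroup (Fin n) ℝ,
    (fun X : Matrix (Fin n) (Fin n) ℝ =>
        Complex.exp (s * X.trace * Complex.I)) ((g : Matrix (Fin n) (Fin n) ℝ) * B) ∂ν with hφ
  set ψ : ℝ → ℂ := fun s => ∫ g : Matrix.orthogonalGroup (Fin n) ℝ,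
    (fun X : Matrix (Fin n) (Fin n) ℝ =>
        (X * X).trace * Complex.exp (s * X.trace * Complex.I))
          ((g : Matrix (Fin n) (Fin n) ℝ) * B) ∂ν with hψ
  have hψb : ∀ s, ‖ψ s‖ ≤ ε * ((n : ℝ) - 1) := by
    intro s
    rw [hε, div_mul_cancel₀ _ hn'.ne']
    refine le_trans (norm_integral_le_integral_norm _) (le_trans (le_of_eq ?_) (estAbsP ν B hn))
    congr 1
    ext g
    simp only [norm_mul, Complex.norm_real, ← Complex.ofReal_mul,
      Complex.norm_exp_ofReal_mul_I, mul_one, Real.norm_eq_abs]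
  have hd : ∀ s, HasDerivAt (fun s : ℝ => φ s * Complex.exp ((v / 2 * s ^ 2 : ℝ) : ℂ))
      (s / ((n : ℂ) - 1) * ψ s * Complex.exp ((v / 2 * s ^ 2 : ℝ) : ℂ)) s := by
    intro s
    have h1 := hasDerivAt_phi ν B s
    rw [deriv_phi_eq ν B hn s] at h1
    have h2 : HasDerivAt (fun s : ℝ => (v / 2 * s ^ 2 : ℝ)) (v * s) s := by
      refine (((hasDerivAt_id' s).pow 2).const_mul (v / 2)).congr_deriv ?_
      norm_num
      ring
    convert! h1.mul h2.ofReal_comp.cexp using 1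
    simp only [hv]
    push_cast
    ring
  have hmain := norm_image_sub_le_of_norm_deriv_le_segment_01' (C := ε * Real.exp (v / 2))
    (fun s _ => (hd s).hasDerivWithinAt) (by
      intro s hs
      have e1 : ‖(n : ℂ) - 1‖ = (n : ℝ) - 1 := by
        have : (n : ℂ) - 1 = (((n : ℝ) - 1 : ℝ) : ℂ) := by push_cast; ring
        rw [this, Complex.norm_real, Real.norm_of_nonneg hn'.le]
      rw [norm_mul, norm_mul, norm_div, e1, Complex.norm_real, Real.norm_of_nonneg hs.1,
        ← Complex.ofReal_exp, Complex.norm_real, Real.norm_of_nonneg (Real.exp_pos _).le]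
      have hε0 : 0 ≤ ε := by positivity
      gcongr
      · calc s / ((n : ℝ) - 1) * ‖ψ s‖ ≤ 1 / ((n : ℝ) - 1) * (ε * ((n : ℝ) - 1)) := by
              gcongr
              · exact hs.2.le
              · exact hψb s
          _ = ε := by field_simp
      · nlinarith [hs.1, hs.2, mul_nonneg hv0 (by nlinarith [hs.1, hs.2] : 0 ≤ 1 - s ^ 2)])
  have e0 : φ 0 = 1 := by simp [hφ]
  have e1 : φ 1 = ∫ g : Matrix.orthogonalGroup (Fin n) ℝ,
        Complex.exp (((g : Matrix (Fin n) (Fin n) ℝ) * B).trace * Complex.I) ∂ν := by simp [hφ]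
  rw [← e1]
  simp only [e0, one_pow, mul_one, ne_eq, OfNat.ofNat_ne_zero, not_false_eq_true, zero_pow,
    mul_zero, Complex.ofReal_zero, Complex.exp_zero] at hmain
  have hfac : φ 1 * Complex.exp ((v / 2 : ℝ) : ℂ) - 1
      = (φ 1 - Complex.exp (-((v / 2 : ℝ) : ℂ))) * Complex.exp ((v / 2 : ℝ) : ℂ) := by
    rw [sub_mul, ← Complex.exp_add]
    simp
  rw [hfac, norm_mul, ← Complex.ofReal_exp, Complex.norm_real,
    Real.norm_of_nonneg (Real.exp_pos _).le] at hmain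
  exact le_of_mul_le_mul_right hmain (Real.exp_pos _)

end estimates

/-! ### Part 4: conclusion -/

/-- The linear combination of matrices. -/
noncomputable def combo {r : ℕ} (A : Fin r → (n : ℕ) → Matrix (Fin n) (Fin n) ℝ) (t : Fin r → ℝ) (n : ℕ) :
    Matrix (Fin n) (Fin n) ℝ := ∑ ν, t ν • A ν n

theorem combo_tr {r : ℕ} (A : Fin r → (n : ℕ) → Matrix (Fin n) (Fin n) ℝ) (t : Fin r → ℝ)
    (n : ℕ) (g : Matrix (Fin n) (Fin n) ℝ) :
    (g * combo A t n).trace = ∑ ν, t ν * (A ν n * g).trace := by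
  rw [Matrix.trace_mul_comm]
  simp [combo, Finset.sum_mul, Matrix.trace_sum]

theorem combo_sq {r : ℕ} (A : Fin r → (n : ℕ) → Matrix (Fin n) (Fin n) ℝ) (t : Fin r → ℝ)
    (n : ℕ) : ((combo A t n)ᵀ * combo A t n).trace
      = ∑ i, ∑ j, t i * (A i n * (A j n)ᵀ).trace * t j := by
  rw [Matrix.trace_mul_comm]
  simp only [combo, Matrix.transpose_sum, Finset.sum_mul_sum, Matrix.trace_sum,
    Matrix.transpose_smul, Matrix.smul_mul, Matrix.mul_smul, Matrix.trace_smul, smul_eq_mul]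
  refine Finset.sum_congr rfl fun i _ => Finset.sum_congr rfl fun j _ => ?_
  ring

theorem combo_lim {r : ℕ} (A : Fin r → (n : ℕ) → Matrix (Fin n) (Fin n) ℝ)
    (c : Matrix (Fin r) (Fin r) ℝ)
    (hc : ∀ μ' ν, Tendsto
      (fun n : ℕ => (1 / (n : ℝ)) * ((A μ' n * (A ν n)ᵀ).trace))
      atTop (𝓝 (c μ' ν))) (t : Fin r → ℝ) :
    Tendsto (fun n : ℕ => (1 / (n : ℝ)) * ((combo A t n)ᵀ * combo A t n).trace) atTop
      (𝓝 (∑ i, ∑ j, t i * c i j * t j)) := by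
  have h : Tendsto (fun n : ℕ => ∑ i, ∑ j, t i * ((1 / (n : ℝ)) * ((A i n * (A j n)ᵀ).trace)) * t j)
      atTop (𝓝 (∑ i, ∑ j, t i * c i j * t j)) :=
    tendsto_finsetSum _ fun i _ => tendsto_finsetSum _ fun j _ =>
      ((hc i j).const_mul _).mul_const _
  refine h.congr fun n => ?_
  rw [combo_sq]
  simp_rw [Finset.mul_sum]
  refine Finset.sum_congr rfl fun i _ => Finset.sum_congr rfl fun j _ => ?_
  ring

theorem c_posSemidef {r : ℕ} (A : Fin r → (n : ℕ) → Matrix (Fin n) (Fin n) ℝ)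
    (c : Matrix (Fin r) (Fin r) ℝ)
    (hc : ∀ μ' ν, Tendsto
      (fun n : ℕ => (1 / (n : ℝ)) * ((A μ' n * (A ν n)ᵀ).trace))
      atTop (𝓝 (c μ' ν))) : c.PosSemidef := by
  refine Matrix.PosSemidef.of_dotProduct_mulVec_nonneg ?_ ?_
  · ext i j
    simp only [Matrix.conjTranspose_apply, star_trivial]
    refine tendsto_nhds_unique (hc j i) ((hc i j).congr fun n => ?_)
    rw [← Matrix.trace_transpose (A j n * _), Matrix.transpose_mul, Matrix.transpose_transpose]
  · intro t
    have h := ge_of_tendsto' (b := 0) (combo_lim A c hc t) fun n =>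
      mul_nonneg (by positivity) (tr_sq_nonneg _)
    refine h.trans_eq ?_
    simp only [dotProduct, Matrix.mulVec, Pi.star_apply, star_trivial, Finset.mul_sum, mul_assoc]

theorem combo_char {r : ℕ} (A : Fin r → (n : ℕ) → Matrix (Fin n) (Fin n) ℝ)
    (c : Matrix (Fin r) (Fin r) ℝ)
    (hc : ∀ μ' ν, Tendsto
      (fun n : ℕ => (1 / (n : ℝ)) * ((A μ' n * (A ν n)ᵀ).trace))
      atTop (𝓝 (c μ' ν)))
    (μ : (n : ℕ) → Measure (Matrix.orthogonalGroup (Fin n) ℝ))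
    (hprob : ∀ n, IsProbabilityMeasure (μ n))
    (hinv : ∀ n, (μ n).IsMulLeftInvariant) (t : Fin r → ℝ) :
    Tendsto (fun n => ∫ g : Matrix.orthogonalGroup (Fin n) ℝ,
        Complex.exp (((g : Matrix (Fin n) (Fin n) ℝ) * combo A t n).trace * Complex.I) ∂(μ n))
      atTop (𝓝 (Complex.exp (-(((∑ i, ∑ j, t i * c i j * t j) / 2 : ℝ) : ℂ)))) := by
  have h1 := combo_lim A c hc t
  have hq : Tendsto (fun n : ℕ => (n : ℝ) / ((n : ℝ) - 1)) atTop (𝓝 1) := by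
    have h := (tendsto_natCast_div_add_atTop (-1 : ℝ))
    simpa [sub_eq_add_neg] using h
  have h2 : Tendsto (fun n : ℕ => ((combo A t n)ᵀ * combo A t n).trace / ((n : ℝ) - 1)) atTop
      (𝓝 (∑ i, ∑ j, t i * c i j * t j)) := by
    have h := h1.mul hq
    rw [mul_one] at h
    refine h.congr' ?_
    filter_upwards [eventually_ge_atTop 1] with n hn
    have : (n : ℝ) ≠ 0 := by positivity
    field_simp
  have hinv0 : Tendsto (fun n : ℕ => ((n : ℝ) - 1)⁻¹) atTop (𝓝 0) :=
    tendsto_inv_atTop_zero.comp (tendsto_atTop_add_const_right _ (-1) tendsto_natCast_atTop_atTop)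
  have h3 : Tendsto (fun n : ℕ => √(7 * ((combo A t n)ᵀ * combo A t n).trace ^ 2 / ((n : ℝ) - 1))
      / ((n : ℝ) - 1)) atTop (𝓝 0) := by
    have h : Tendsto (fun n : ℕ => √(7 * (((combo A t n)ᵀ * combo A t n).trace / ((n : ℝ) - 1)) ^ 2
        * ((n : ℝ) - 1)⁻¹)) atTop (𝓝 0) := by
      have := (((h2.pow 2).const_mul 7).mul hinv0).sqrt
      simpa using this
    refine h.congr' ?_
    filter_upwards [eventually_ge_atTop 2] with n hn
    have hn' : (0 : ℝ) < (n : ℝ) - 1 := by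
      have : (2 : ℝ) ≤ n := by exact_mod_cast hn
      linarith
    rw [eq_div_iff hn'.ne']
    nth_rewrite 3 [← Real.sqrt_sq hn'.le]
    rw [← Real.sqrt_mul' _ (by positivity)]
    congr 1
    field_simp
  have h4 : Tendsto (fun n : ℕ => Complex.exp
      (-((((combo A t n)ᵀ * combo A t n).trace / ((n : ℝ) - 1) / 2 : ℝ) : ℂ))) atTop
      (𝓝 (Complex.exp (-(((∑ i, ∑ j, t i * c i j * t j) / 2 : ℝ) : ℂ)))) := by
    have : Continuous fun x : ℝ => Complex.exp (-((x / 2 : ℝ) : ℂ)) := by fun_prop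
    exact (this.tendsto _).comp h2
  have h5 := squeeze_zero_norm' (f := fun n : ℕ => (∫ g : Matrix.orthogonalGroup (Fin n) ℝ,
        Complex.exp (((g : Matrix (Fin n) (Fin n) ℝ) * combo A t n).trace * Complex.I) ∂(μ n)) -
        Complex.exp
      (-((((combo A t n)ᵀ * combo A t n).trace / ((n : ℝ) - 1) / 2 : ℝ) : ℂ))) (by
      filter_upwards [eventually_ge_atTop 2] with n hn
      have := hprob n
      have := hinv n
      exact phi_bound (μ n) (combo A t n) hn) h3
  have h6 := h5.add h4
  simpa using h6

theorem gaussian_isGaussian {r : ℕ} (c : Matrix (Fin r) (Fin r) ℝ) (hS : c.PosSemidef) :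
    IsGaussianMeasure ((multivariateGaussian 0 c).map
      (fun x : EuclideanSpace ℝ (Fin r) => (WithLp.ofLp x : Fin r → ℝ))) 0 c := by
  have hm : Measurable (fun x : EuclideanSpace ℝ (Fin r) => (WithLp.ofLp x : Fin r → ℝ)) := by
    fun_prop
  refine ⟨Measure.isProbabilityMeasure_map hm.aemeasurable, fun t => ?_⟩
  have hm2 : Measurable (fun x : Fin r → ℝ => ∑ i, t i * x i) := by fun_prop
  rw [Measure.map_map hm2 hm]
  have : IsProbabilityMeasure ((multivariateGaussian 0 c).map
    ((fun x : Fin r → ℝ => ∑ i, t i * x i) ∘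
      (fun x : EuclideanSpace ℝ (Fin r) => (WithLp.ofLp x : Fin r → ℝ)))) :=
    Measure.isProbabilityMeasure_map (hm2.comp hm).aemeasurable
  apply Measure.ext_of_charFun
  ext s
  have hq : 0 ≤ ∑ i, ∑ j, t i * c i j * t j := by
    refine (hS.dotProduct_mulVec_nonneg t).trans_eq ?_
    simp only [dotProduct, Matrix.mulVec, Pi.star_apply, star_trivial, Finset.mul_sum, mul_assoc]
  rw [charFun_gaussianReal, charFun_apply_real, integral_map (hm2.comp hm).aemeasurable
    (by fun_prop)]
  have key := charFun_multivariateGaussian (μ := 0) hS (WithLp.toLp 2 (s • t))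
  rw [charFun_apply] at key
  have e : ∀ x : EuclideanSpace ℝ (Fin r), ((inner ℝ x (WithLp.toLp 2 (s • t)) : ℝ) : ℂ)
      = s * (((fun x : Fin r → ℝ => ∑ i, t i * x i) ∘
      (fun x : EuclideanSpace ℝ (Fin r) => (WithLp.ofLp x : Fin r → ℝ))) x : ℝ) := by
    intro x
    rw [← Complex.ofReal_mul]
    congr 1
    simp only [PiLp.inner_apply, Function.comp, Finset.mul_sum]
    refine Finset.sum_congr rfl fun i _ => ?_
    simp
    ring
  simp_rw [e] at key
  rw [key, Real.coe_toNNReal _ hq]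
  congr 1
  have e2 : (s • t) ⬝ᵥ c *ᵥ (s • t) = (∑ i, ∑ j, t i * c i j * t j) * s ^ 2 := by
    simp only [dotProduct, Matrix.mulVec, Finset.mul_sum, Finset.sum_mul, Pi.smul_apply,
      smul_eq_mul]
    refine Finset.sum_congr rfl fun i _ => Finset.sum_congr rfl fun j _ => ?_
    ring
  rw [e2]
  simp

/-- Borel theorem for the orthogonal group (class B/D): the random vector
`(Tr(A^{(1,n)} g), …, Tr(A^{(r,n)} g))`, with `g` Haar distributed on `O(n)`,
converges in distribution to the centered Gaussian with covariances
`c μ ν = lim (1/n) Tr(A^{(μ,n)} (A^{(ν,n)})ᵀ)`. -/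
theorem borel_theorem_orthogonal
    (r : ℕ) (hr : 1 ≤ r)
    (A : Fin r → (n : ℕ) → Matrix (Fin n) (Fin n) ℝ)
    (c : Matrix (Fin r) (Fin r) ℝ)
    (hc : ∀ μ' ν, Tendsto
      (fun n : ℕ => (1 / (n : ℝ)) * ((A μ' n * (A ν n)ᵀ).trace))
      atTop (𝓝 (c μ' ν)))
    (hpos : ∀ ν, 0 < c ν ν)
    (μ : (n : ℕ) → Measure (Matrix.orthogonalGroup (Fin n) ℝ))
    (hprob : ∀ n, IsProbabilityMeasure (μ n))
    (hinv : ∀ n, (μ n).IsMulLeftInvariant) :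
    ∃ γ : Measure (Fin r → ℝ), IsGaussianMeasure γ 0 c ∧
      ∀ f : BoundedContinuousFunction (Fin r → ℝ) ℝ,
        Tendsto
          (fun n : ℕ => ∫ g, f (fun ν =>
            ((A ν n * (g : Matrix (Fin n) (Fin n) ℝ)).trace)) ∂ μ n)
          atTop (𝓝 (∫ x, f x ∂ γ)) := by
  have hS := c_posSemidef A c hc
  refine ⟨_, gaussian_isGaussian c hS, fun f => ?_⟩
  have hb := fun n => og_borel n
  let V : (n : ℕ) → Matrix.orthogonalGroup (Fin n) ℝ → EuclideanSpace ℝ (Fin r) :=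
    fun n g => WithLp.toLp 2 (fun ν => ((A ν n * (g : Matrix (Fin n) (Fin n) ℝ)).trace))
  have hV : ∀ n, Continuous (V n) := by
    intro n
    simp only [V]
    fun_prop
  have hVm : ∀ n, Measurable (V n) := fun n => (hV n).measurable
  let P : ℕ → ProbabilityMeasure (EuclideanSpace ℝ (Fin r)) := fun n =>
    ⟨(μ n).map (V n), Measure.isProbabilityMeasure_map (hVm n).aemeasurable⟩
  let P0 : ProbabilityMeasure (EuclideanSpace ℝ (Fin r)) :=
    ⟨multivariateGaussian 0 c, inferInstance⟩
  have hlim : Tendsto P atTop (𝓝 P0) := by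
    apply ProbabilityMeasure.tendsto_of_tendsto_charFun
    intro t
    have h := combo_char A c hc μ hprob hinv (WithLp.ofLp t)
    have e0 : charFun (P0 : Measure (EuclideanSpace ℝ (Fin r))) t
        = Complex.exp (-(((∑ i, ∑ j, t i * c i j * t j) / 2 : ℝ) : ℂ)) := by
      change charFun (multivariateGaussian 0 c) t = _
      rw [charFun_multivariateGaussian hS]
      congr 1
      simp [dotProduct, Matrix.mulVec, Finset.mul_sum, mul_assoc]
    rw [e0]
    refine h.congr fun n => ?_
    change _ = charFun ((μ n).map (V n)) t
    rw [charFun_apply, integral_map (hVm n).aemeasurable (by fun_prop)]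
    congr 1
    ext g
    rw [combo_tr]
    simp [V, PiLp.inner_apply]
  rw [ProbabilityMeasure.tendsto_iff_forall_integral_tendsto] at hlim
  have hm : Continuous (fun x : EuclideanSpace ℝ (Fin r) => (WithLp.ofLp x : Fin r → ℝ)) := by
    fun_prop
  have h := hlim (f.compContinuous ⟨_, hm⟩)
  rw [integral_map hm.measurable.aemeasurable f.continuous.aestronglyMeasurable]
  refine Tendsto.congr (fun n => ?_) h
  change ∫ x, f (WithLp.ofLp x) ∂((μ n).map (V n)) = _
  exact integral_map (hVm n).aemeasurable (f.continuous.comp hm).aestronglyMeasurable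
end

section
/- Let k = 2l be even, let n ≥ l, let φ, ψ : {1,…,k} → {1,…,n}, and let α, β : {1,…,k} → {0,1}. Identify M(k) with the set of ordered pair partitions m° = {(m_ν, n_ν) : ν = 1,…,l} of {1,…,2l} with m_ν < n_ν for all ν. Then the Gram matrix (a(θ_{m°}, θ_{n°}))_{m°,n° ∈ M(k)} is invertible and, denoting its inverse by Wg, one has ∫_{Sp(2n)} ∏_{j=1}^k g_{φ(j)+nα(j), ψ(j)+nβ(j)} dλ(g) = Σ_{m°, n° ∈ M(k)} Wg(m°, n°) · (−1)^{#{ν : α(m_ν)=0} + #{ν : β(m'_ν)=0}} · 1[φ+nα ∈ F(m°, 2n)] · 1[ψ+nβ ∈ F(n°, 2n)], where m° = {(m_ν, n_ν) : ν=1,…,l} and n° = {(m'_ν, n'_ν) : ν=1,…,l}. Moreover, for odd k the integral ∫_{Sp(2n)} ∏_{j=1}^k g_{φ(j)+nα(j), ψ(j)+nβ(j)} dλ(g) vanishes. -/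
open MeasureTheory Matrix

open scoped Classical

/-- The complex `2n×2n` block matrix `J = [[0, -Iₙ],[Iₙ, 0]]`. -/
def Jmat (n : ℕ) : Matrix (Fin n ⊕ Fin n) (Fin n ⊕ Fin n) ℂ :=
  Matrix.fromBlocks 0 (-1) 1 0

/-- The compact symplectic group `Sp(2n)`, i.e. the set of `2n×2n` complex
matrices which are unitary and satisfy `gᵀ J g = J`. -/
def Sp (n : ℕ) : Set (Matrix (Fin n ⊕ Fin n) (Fin n ⊕ Fin n) ℂ) :=
  {g | g ∈ Matrix.unitaryGroup (Fin n ⊕ Fin n) ℂ ∧ gᵀ * Jmat n * g = Jmat n}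

/-- The index `i + n·s` of `{1,…,2n}`, encoded in `Fin n ⊕ Fin n`:
`inl i` for `s = 0` (i.e. the index `i`), `inr i` for `s = 1` (the index `n+i`). -/
def idx (n : ℕ) (i : Fin n) (s : Fin 2) : Fin n ⊕ Fin n :=
  if s = 0 then Sum.inl i else Sum.inr i

/-- The standard skew-symmetric bilinear form `a` on `ℂ^{2n}`, with
`a(e_i, e_{n+i}) = 1 = -a(e_{n+i}, e_i)` and `a(e_i, e_j) = 0` for `|i-j| ≠ n`. -/
noncomputable def aForm (n : ℕ) (v w : (Fin n ⊕ Fin n) → ℂ) : ℂ :=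
  ∑ i : Fin n, (v (Sum.inl i) * w (Sum.inr i) - v (Sum.inr i) * w (Sum.inl i))

/-- Ordered pair partitions `{(m_ν, n_ν) : ν = 1,…,l}` of `{1,…,k}` with
`m_ν < n_ν` for all `ν` (listed with `m_1 < m_2 < ⋯`, so that they are in
canonical bijection with the pair partitions `M(k)`). -/
abbrev OrderedPairPartition (k l : ℕ) : Type :=
  {f : Fin l → Fin k × Fin k //
    (∀ ν, (f ν).1 < (f ν).2) ∧
    (∀ ν ν' : Fin l, ν < ν' → (f ν).1 < (f ν').1) ∧
    ∀ x : Fin k, ∃! ν, x = (f ν).1 ∨ x = (f ν).2}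

noncomputable instance (k l : ℕ) : Fintype (OrderedPairPartition k l) :=
  Fintype.ofFinite _

/-- The vector `v(η, ε, j)`: equal to `e_{η(ν)+nε(ν)}` if `j = m_ν`, and to
`(-1)^{ε(ν)} e_{η(ν)+n(1-ε(ν))}` if `j = n_ν`. -/
noncomputable def vvec (n k l : ℕ) (f : Fin l → Fin k × Fin k)
    (η : Fin l → Fin n) (ε : Fin l → Fin 2) (j : Fin k) :
    (Fin n ⊕ Fin n) → ℂ :=
  if h : ∃ ν, (f ν).1 = j then
    (Pi.single (idx n (η h.choose) (ε h.choose)) 1 : (Fin n ⊕ Fin n) → ℂ)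
  else if h' : ∃ ν, (f ν).2 = j then
    ((-1 : ℂ) ^ ((ε h'.choose : ℕ))) •
      (Pi.single (idx n (η h'.choose) (1 - ε h'.choose)) 1 : (Fin n ⊕ Fin n) → ℂ)
  else 0

/-- The Gram matrix `a(θ_{m°}, θ_{n°})` of the invariant vectors
`θ_{m°} = ∑_{η,ε} ⊗ⱼ v(η,ε,j)`, computed via
`a(⊗ⱼ vⱼ, ⊗ⱼ wⱼ) = ∏ⱼ a(vⱼ, wⱼ)` and bilinearity. -/
noncomputable def gramSp (n k l : ℕ) :
    Matrix (OrderedPairPartition k l) (OrderedPairPartition k l) ℂ :=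
  fun f f' =>
    ∑ η : Fin l → Fin n, ∑ ε : Fin l → Fin 2,
      ∑ η' : Fin l → Fin n, ∑ ε' : Fin l → Fin 2,
        ∏ j : Fin k, aForm n (vvec n k l f.1 η ε j) (vvec n k l f'.1 η' ε' j)

/-- `φ + nα ∈ F(m°, 2n)`: `φ` is constant on each pair of `m°` and `α` takes
both values `0» and `1` on each pair. -/
def MemF {n k l : ℕ} (f : Fin l → Fin k × Fin k)
    (φ : Fin k → Fin n) (α : Fin k → Fin 2) : Prop :=
  ∀ ν, φ (f ν).1 = φ (f ν).2 ∧ α (f ν).1 ≠ α (f ν).2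


namespace SpW

abbrev X (n : ℕ) := Fin n ⊕ Fin n

/-- The matrix of the form `a`. -/
def A (n : ℕ) : Matrix (X n) (X n) ℂ := Matrix.fromBlocks 0 1 (-1) 0

lemma A_eq (n : ℕ) : A n = - Jmat n := by
  simp [A, Jmat, Matrix.fromBlocks_neg]

/-- bijection of the positions -/
noncomputable def posEquiv {k l : ℕ} (f : OrderedPairPartition k l) : Fin l ⊕ Fin l ≃ Fin k :=
  Equiv.ofBijective (Sum.elim (fun ν => (f.1 ν).1) (fun ν => (f.1 ν).2)) (by
    obtain ⟨f, h1, h2, h3⟩ := f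
    constructor
    · rintro (a | a) (b | b) hab <;> simp only [Sum.elim_inl, Sum.elim_inr] at hab
      · rw [(h3 (f a).1).unique (Or.inl rfl) (Or.inl hab)]
      · have := (h3 (f a).1).unique (Or.inl rfl) (Or.inr hab)
        subst this
        exact absurd hab (h1 a).ne
      · have := (h3 (f a).2).unique (Or.inr rfl) (Or.inl hab)
        subst this
        exact absurd hab.symm (h1 a).ne
      · rw [(h3 (f a).2).unique (Or.inr rfl) (Or.inr hab)]
    · intro x
      obtain ⟨ν, hν | hν, -⟩ := h3 x
      · exact ⟨Sum.inl ν, hν.symm⟩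
      · exact ⟨Sum.inr ν, hν.symm⟩)

@[simp] lemma posEquiv_inl {k l : ℕ} (f : OrderedPairPartition k l) (ν : Fin l) :
    posEquiv f (Sum.inl ν) = (f.1 ν).1 := rfl
@[simp] lemma posEquiv_inr {k l : ℕ} (f : OrderedPairPartition k l) (ν : Fin l) :
    posEquiv f (Sum.inr ν) = (f.1 ν).2 := rfl

lemma prod_split {k l : ℕ} (f : OrderedPairPartition k l) (F : Fin k → ℂ) :
    ∏ j, F j = ∏ ν, F (f.1 ν).1 * F (f.1 ν).2 := by
  rw [← (posEquiv f).prod_comp, Fintype.prod_sum_type, Finset.prod_mul_distrib]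
  rfl

lemma prod_sum_fun {l : ℕ} {Y : Type*} [Fintype Y] (F : Fin l → Y → ℂ) :
    ∏ ν, ∑ y, F ν y = ∑ p : Fin l → Y, ∏ ν, F ν (p ν) := by
  classical
  rw [Finset.prod_univ_sum, Fintype.piFinset_univ]

/-- splitting multi-indices in pairs -/
noncomputable def idxEquiv {k l : ℕ} (f : OrderedPairPartition k l) (Y : Type*) :
    (Fin k → Y) ≃ (Fin l → Y × Y) :=
  ((posEquiv f).arrowCongr (Equiv.refl Y)).symm.trans
    ((Equiv.sumArrowEquivProdArrow _ _ _).trans (Equiv.arrowProdEquivProdArrow _ _ _).symm)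

lemma idxEquiv_apply {k l : ℕ} (f : OrderedPairPartition k l) (Y : Type*) (I : Fin k → Y)
    (ν : Fin l) : idxEquiv f Y I ν = (I (f.1 ν).1, I (f.1 ν).2) := rfl

lemma sum_split {k l : ℕ} (f : OrderedPairPartition k l) {Y : Type*} [Fintype Y]
    (F : Fin l → Y → Y → ℂ) :
    ∑ I : Fin k → Y, ∏ ν, F ν (I (f.1 ν).1) (I (f.1 ν).2) = ∏ ν, ∑ a, ∑ b, F ν a b := by
  have : ∀ ν, ∑ a, ∑ b, F ν a b = ∑ p : Y × Y, F ν p.1 p.2 := fun ν => by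
    rw [Fintype.sum_prod_type]
  simp_rw [this]
  rw [prod_sum_fun, ← (idxEquiv f Y).sum_comp]
  rfl

/-- The coefficients of the tensor `θ`. -/
noncomputable def theta {n k l : ℕ} (f : OrderedPairPartition k l) (I : Fin k → X n) : ℂ :=
  ∏ ν, A n (I (f.1 ν).1) (I (f.1 ν).2)

/-- Invariance of a tensor. -/
def Inv {n k : ℕ} (T : (Fin k → X n) → ℂ) : Prop :=
  ∀ h ∈ Sp n, ∀ J, ∑ I : Fin k → X n, (∏ j, h (J j) (I j)) * T I = T J

lemma Jmat_sq (n : ℕ) : Jmat n * Jmat n = -1 := by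
  simp [Jmat, Matrix.fromBlocks_multiply, ← Matrix.fromBlocks_one, Matrix.fromBlocks_neg]

lemma Sp_A {n : ℕ} {h : Matrix (X n) (X n) ℂ} (hh : h ∈ Sp n) : hᵀ * A n * h = A n := by
  have := hh.2
  rw [A_eq]
  simp [this]

lemma Sp_transpose {n : ℕ} {h : Matrix (X n) (X n) ℂ} (hh : h ∈ Sp n) : h * A n * hᵀ = A n := by
  have h1 := hh.2
  have h2 : (-(Jmat n) * hᵀ * Jmat n) * h = 1 := by
    rw [Matrix.mul_assoc, Matrix.mul_assoc, ← Matrix.mul_assoc hᵀ, h1, Matrix.neg_mul, Jmat_sq,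
      neg_neg]
  have h3 := mul_eq_one_comm.mp h2
  rw [A_eq]
  calc h * -Jmat n * hᵀ = (h * (-(Jmat n) * hᵀ * Jmat n)) * (-(Jmat n)) := by
        have := Jmat_sq n
        simp only [Matrix.mul_assoc, Matrix.mul_neg, this, Matrix.neg_mul, Matrix.mul_one]
        simp
    _ = _ := by rw [h3, Matrix.one_mul]

lemma theta_inv {n k l : ℕ} (f : OrderedPairPartition k l) : Inv (theta (n := n) f) := by
  intro h hh J
  unfold theta
  simp_rw [prod_split f, ← Finset.prod_mul_distrib]
  rw [sum_split f (fun ν a b => h (J (f.1 ν).1) a * h (J (f.1 ν).2) b * A n a b)]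
  refine Finset.prod_congr rfl fun ν _ => ?_
  conv_rhs => rw [← Sp_transpose hh]
  simp only [Matrix.mul_apply, Matrix.transpose_apply, Finset.sum_mul]
  rw [Finset.sum_comm]
  refine Finset.sum_congr rfl fun a _ => Finset.sum_congr rfl fun b _ => ?_
  ring

/-- the transposed invariance -/
lemma theta_inv' {n k l : ℕ} (f : OrderedPairPartition k l) {h : Matrix (X n) (X n) ℂ}
    (hh : h ∈ Sp n) (J : Fin k → X n) :
    ∑ I : Fin k → X n, theta f I * (∏ j, h (I j) (J j)) = theta f J := by
  unfold theta
  simp_rw [prod_split f, ← Finset.prod_mul_distrib]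
  rw [sum_split f (fun ν a b => A n a b * (h a (J (f.1 ν).1) * h b (J (f.1 ν).2)))]
  refine Finset.prod_congr rfl fun ν _ => ?_
  conv_rhs => rw [← Sp_A hh]
  simp only [Matrix.mul_apply, Matrix.transpose_apply, Finset.sum_mul]
  rw [Finset.sum_comm]
  refine Finset.sum_congr rfl fun a _ => Finset.sum_congr rfl fun b _ => ?_
  ring

/-- monomial matrices -/
def mono {n : ℕ} (π : Equiv.Perm (X n)) (c : X n → ℂ) : Matrix (X n) (X n) ℂ :=
  fun a b => if a = π b then c b else 0

lemma mono_mem {n : ℕ} (π : Equiv.Perm (X n)) (c : X n → ℂ)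
    (hc : ∀ b, star (c b) * c b = 1)
    (hJ : ∀ a b, c a * c b * Jmat n (π a) (π b) = Jmat n a b) : mono π c ∈ Sp n := by
  constructor
  · rw [Matrix.mem_unitaryGroup_iff']
    ext a b
    simp only [Matrix.mul_apply, Matrix.star_apply, mono, apply_ite star, star_zero, ite_mul,
      zero_mul, mul_ite, mul_zero, Finset.sum_ite_eq', Finset.mem_univ, if_true,
      Matrix.one_apply, EmbeddingLike.apply_eq_iff_eq]
    by_cases h : a = b
    · subst h; simpa using hc a
    · simp [h, Ne.symm h]
  · ext a b
    rw [← hJ]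
    simp only [Matrix.mul_apply, Matrix.transpose_apply, mono, ite_mul,
      zero_mul, mul_ite, mul_zero, Finset.sum_ite_eq', Finset.mem_univ, if_true]
    ring

lemma Inv.mono {n k : ℕ} {T : (Fin k → X n) → ℂ} (hT : Inv T) (π : Equiv.Perm (X n))
    (c : X n → ℂ) (hm : mono π c ∈ Sp n) (I : Fin k → X n) :
    T (fun j => π (I j)) = (∏ j, c (I j)) * T I := by
  rw [← hT _ hm, Finset.sum_eq_single I]
  · simp [SpW.mono]
  · intro K _ hK
    obtain ⟨j, hj⟩ := Function.ne_iff.mp hK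
    rw [Finset.prod_eq_zero (Finset.mem_univ j), zero_mul]
    simp [SpW.mono, Ne.symm hj]
  · simp

end SpW

namespace SpW

lemma torus_mem {n : ℕ} (i : Fin n) (z : ℂ) (hz : star z * z = 1) :
    mono (Equiv.refl (X n)) (fun b => if b = Sum.inl i then z else if b = Sum.inr i then star z else 1)
      ∈ Sp n := by
  have hz' : z * star z = 1 := by rw [mul_comm]; exact hz
  apply mono_mem
  · intro b
    split_ifs
    · exact hz
    · simpa using hz'
    · simp
  · rintro (a | a) (b | b)
    · simp [Jmat]
    · simp only [Jmat, Equiv.refl_apply, Matrix.fromBlocks_apply₁₂, Matrix.neg_apply,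
        Matrix.one_apply]
      by_cases hab : a = b
      · subst hab
        by_cases hi : a = i <;> simp_all
      · simp [hab]
    · simp only [Jmat, Equiv.refl_apply, Matrix.fromBlocks_apply₂₁, Matrix.one_apply]
      by_cases hab : a = b
      · subst hab
        by_cases hi : a = i <;> simp_all
      · simp [hab]
    · simp [Jmat]

/-- number of occurrences -/
def cnt {n k : ℕ} (I : Fin k → X n) (a : X n) : ℕ := (Finset.univ.filter fun j => I j = a).card

lemma Inv.balanced {n k : ℕ} {T : (Fin k → X n) → ℂ} (hT : Inv T) (I : Fin k → X n)
    (i : Fin n) (hne : cnt I (Sum.inl i) ≠ cnt I (Sum.inr i)) : T I = 0 := by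
  set m : ℤ := (cnt I (Sum.inl i) : ℤ) - cnt I (Sum.inr i) with hm
  have hm0 : (m : ℂ) ≠ 0 := by
    have : m ≠ 0 := by omega
    exact_mod_cast this
  set z : ℂ := Complex.exp (((Real.pi / m : ℝ) : ℂ) * Complex.I) with hzdef
  have hz : star z * z = 1 := by
    have h1 : ‖z‖ = 1 := Complex.norm_exp_ofReal_mul_I _
    rw [Complex.star_def, ← Complex.normSq_eq_conj_mul_self, Complex.normSq_eq_norm_sq, h1]
    simp
  have hsz : star z = z⁻¹ := eq_inv_of_mul_eq_one_left hz
  have hz0 : z ≠ 0 := Complex.exp_ne_zero _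
  have h := hT.mono _ _ (torus_mem i z hz) I
  have hprod : (∏ j, (if I j = Sum.inl i then z else if I j = Sum.inr i then star z else 1)) = -1 := by
    have : ∀ j, (if I j = Sum.inl i then z else if I j = Sum.inr i then star z else 1)
        = (if I j = Sum.inl i then z else 1) * (if I j = Sum.inr i then star z else 1) := by
      intro j
      by_cases h1 : I j = Sum.inl i <;> simp [h1]
    simp_rw [this]
    rw [Finset.prod_mul_distrib, Finset.prod_ite, Finset.prod_ite]
    simp only [Finset.prod_const, one_pow, mul_one]
    change z ^ (cnt I (Sum.inl i)) * (star z) ^ (cnt I (Sum.inr i)) = -1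
    rw [hsz, inv_pow, ← div_eq_mul_inv, ← zpow_natCast, ← zpow_natCast, ← zpow_sub₀ hz0, ← hm,
      hzdef, ← Complex.exp_int_mul]
    rw [← Complex.exp_pi_mul_I]
    congr 1
    push_cast
    field_simp
  rw [hprod] at h
  have h' : T I = -1 * T I := h
  have : (2 : ℂ) * T I = 0 := by linear_combination h'
  simpa using this

/-- generator of the rotation -/
def X0 {n : ℕ} (i i' : Fin n) : Matrix (Fin n) (Fin n) ℂ :=
  Matrix.single i i' 1 - Matrix.single i' i 1
def P0 {n : ℕ} (i i' : Fin n) : Matrix (Fin n) (Fin n) ℂ :=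
  Matrix.single i i 1 + Matrix.single i' i' 1
noncomputable def R0 {n : ℕ} (i i' : Fin n) (t : ℝ) : Matrix (Fin n) (Fin n) ℂ :=
  1 + ((Real.cos t : ℂ) - 1) • P0 i i' + (Real.sin t : ℂ) • X0 i i'
noncomputable def R {n : ℕ} (i i' : Fin n) (t : ℝ) : Matrix (X n) (X n) ℂ :=
  Matrix.fromBlocks (R0 i i' t) 0 0 (R0 i i' t)

lemma R0_orth {n : ℕ} {i i' : Fin n} (h : i ≠ i') (t : ℝ) : (R0 i i' t)ᵀ * R0 i i' t = 1 := by
  have hP : P0 i i' * P0 i i' = P0 i i' := by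
    simp [P0, Matrix.add_mul, Matrix.mul_add, h, h.symm]
  have hPX : P0 i i' * X0 i i' = X0 i i' := by
    simp [P0, X0, Matrix.add_mul, Matrix.mul_sub, h, h.symm]
    try abel
  have hXP : X0 i i' * P0 i i' = X0 i i' := by
    simp [P0, X0, Matrix.sub_mul, Matrix.mul_add, h, h.symm]
    abel
  have hX : X0 i i' * X0 i i' = - P0 i i' := by
    simp [P0, X0, Matrix.sub_mul, Matrix.mul_sub, h, h.symm]
    abel
  have hPt : (P0 i i')ᵀ = P0 i i' := by simp [P0]
  have hXt : (X0 i i')ᵀ = - X0 i i' := by simp [X0]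
  have hcs : (Real.cos t : ℂ) ^ 2 + (Real.sin t : ℂ) ^ 2 = 1 := by
    exact_mod_cast Real.cos_sq_add_sin_sq t
  unfold R0
  generalize (Real.cos t : ℂ) = c at *
  generalize (Real.sin t : ℂ) = s at *
  simp only [Matrix.transpose_add, Matrix.transpose_one, Matrix.transpose_smul, hPt, hXt,
    Matrix.add_mul, Matrix.mul_add, Matrix.smul_mul, Matrix.mul_smul, Matrix.neg_mul, hP, hPX, hXP,
    hX, Matrix.one_mul, Matrix.mul_one, smul_neg, neg_neg]
  have : (2 * (c - 1) + (c - 1) * (c - 1) + s * s) = 0 := by linear_combination hcs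
  calc _ = 1 + (2 * (c - 1) + (c - 1) * (c - 1) + s * s) • P0 i i' := by module
    _ = 1 := by rw [this]; simp

lemma R0_star {n : ℕ} (i i' : Fin n) (t : ℝ) : (R0 i i' t)ᴴ = (R0 i i' t)ᵀ := by
  simp [R0, P0, X0, Matrix.conjTranspose_add, Matrix.conjTranspose_smul, Matrix.conjTranspose_sub,
    Complex.conj_ofReal, -Complex.ofReal_cos, -Complex.ofReal_sin]

lemma R_mem {n : ℕ} {i i' : Fin n} (h : i ≠ i') (t : ℝ) : R i i' t ∈ Sp n := by
  have h1 := R0_orth h t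
  have h2 := R0_star i i' t
  constructor
  · rw [Matrix.mem_unitaryGroup_iff', Matrix.star_eq_conjTranspose, R,
      Matrix.fromBlocks_conjTranspose, Matrix.fromBlocks_multiply]
    simp [h2, h1]
  · simp [R, Jmat, Matrix.fromBlocks_transpose, Matrix.fromBlocks_multiply, h1]

def XX {n : ℕ} (i i' : Fin n) : Matrix (X n) (X n) ℂ :=
  Matrix.fromBlocks (X0 i i') 0 0 (X0 i i')

lemma R_zero {n : ℕ} (i i' : Fin n) : R i i' 0 = 1 := by
  simp [R, R0]

lemma R_deriv {n : ℕ} (i i' : Fin n) (a b : X n) :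
    HasDerivAt (fun t => R i i' t a b) (XX i i' a b) 0 := by
  have h0 : ∀ a b : Fin n, HasDerivAt (fun t => R0 i i' t a b) (X0 i i' a b) 0 := by
    intro a b
    have hc := (Real.hasDerivAt_cos 0).ofReal_comp
    have hs := (Real.hasDerivAt_sin 0).ofReal_comp
    have := ((hc.sub_const 1).mul_const (P0 i i' a b)).add (hs.mul_const (X0 i i' a b))
    have := this.const_add ((1 : Matrix (Fin n) (Fin n) ℂ) a b)
    have heq : (fun t => R0 i i' t a b) = (fun x => (1 : Matrix (Fin n) (Fin n) ℂ) a b +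
        ((fun y : ℝ => ((Real.cos y : ℂ) - 1) * P0 i i' a b)
          + fun y : ℝ => (Real.sin y : ℂ) * X0 i i' a b) x) := by
      funext t
      simp only [R0, Matrix.add_apply, Matrix.smul_apply, smul_eq_mul, Pi.add_apply]
      ring
    rw [heq]
    simpa using this
  rcases a with a | a <;> rcases b with b | b
  · exact h0 a b
  · exact hasDerivAt_const _ _
  · exact hasDerivAt_const _ _
  · exact h0 a b

lemma Inv.lie {n k : ℕ} {T : (Fin k → X n) → ℂ} (hT : Inv T) {i i' : Fin n} (h : i ≠ i')
    (J : Fin k → X n) :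
    ∑ j, ∑ a, XX i i' (J j) a * T (Function.update J j a) = 0 := by
  have h1 : HasDerivAt (fun t => ∑ I : Fin k → X n, (∏ j, R i i' t (J j) (I j)) * T I)
      (∑ I : Fin k → X n, (∑ j, (∏ j' ∈ Finset.univ.erase j, R i i' 0 (J j') (I j'))
        • XX i i' (J j) (I j)) * T I) 0 := by
    refine HasDerivAt.fun_sum fun I _ => ?_
    refine HasDerivAt.mul_const ?_ _
    exact HasDerivAt.fun_finsetProd fun j _ => R_deriv i i' _ _
  have h2 : (fun t => ∑ I : Fin k → X n, (∏ j, R i i' t (J j) (I j)) * T I) = fun _ => T J := by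
    ext t
    exact hT _ (R_mem h t) J
  rw [h2] at h1
  have h3 := h1.unique (hasDerivAt_const _ _)
  rw [← h3]
  simp_rw [Finset.sum_mul]
  conv_rhs => rw [Finset.sum_comm]
  refine Finset.sum_congr rfl fun j _ => ?_
  refine Finset.sum_of_injOn (M := ℂ) (fun a => Function.update J j a) ?_ ?_ ?_ ?_
  · intro a _ b _ hab
    exact Function.update_injective J j hab
  · intro a _; simp
  · intro I _ hI
    have : ∃ j' ∈ Finset.univ.erase j, J j' ≠ I j' := by
      by_contra hcon
      push Not at hcon
      apply hI
      refine ⟨I j, by simp, ?_⟩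
      ext1 j'
      by_cases hj : j' = j
      · subst hj; simp
      · simp only [Function.update_of_ne hj]
        exact hcon j' (by simp [hj])
    obtain ⟨j', hj', hne⟩ := this
    rw [Finset.prod_eq_zero hj']
    · simp
    · rw [R_zero, Matrix.one_apply_ne hne]
  · intro a _
    rw [Finset.prod_eq_one]
    · simp
    · intro j' hj'
      rw [R_zero, Function.update_of_ne (Finset.ne_of_mem_erase hj'), Matrix.one_apply_eq]

end SpW

namespace SpW

/-- the label of an index -/
def lab {n : ℕ} (a : X n) : Fin n := Sum.elim id id a

@[simp] lemma lab_inl {n : ℕ} (i : Fin n) : lab (Sum.inl i : X n) = i := rfl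
@[simp] lemma lab_inr {n : ℕ} (i : Fin n) : lab (Sum.inr i : X n) = i := rfl

/-- canonical multi-index adapted to a pair partition -/
noncomputable def canon {n k l : ℕ} (h : l ≤ n) (f : OrderedPairPartition k l) (j : Fin k) : X n :=
  Sum.map (Fin.castLE h) (Fin.castLE h) ((posEquiv f).symm j)

lemma canon_fst {n k l : ℕ} (h : l ≤ n) (f : OrderedPairPartition k l) (ν : Fin l) :
    canon h f (f.1 ν).1 = Sum.inl (Fin.castLE h ν) := by
  rw [← posEquiv_inl f, canon, Equiv.symm_apply_apply]; rfl

lemma canon_snd {n k l : ℕ} (h : l ≤ n) (f : OrderedPairPartition k l) (ν : Fin l) :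
    canon h f (f.1 ν).2 = Sum.inr (Fin.castLE h ν) := by
  rw [← posEquiv_inr f, canon, Equiv.symm_apply_apply]; rfl

lemma A_ne {n : ℕ} {a b : X n} (h : A n a b ≠ 0) : b = a.swap := by
  rcases a with a | a <;> rcases b with b | b <;> simp [A, Matrix.one_apply] at h ⊢
  · exact h.symm
  · exact h.symm

lemma theta_canon_self {n k l : ℕ} (h : l ≤ n) (f : OrderedPairPartition k l) :
    theta f (canon h f) = 1 := by
  unfold theta
  apply Finset.prod_eq_one
  intro ν _
  rw [canon_fst, canon_snd]
  simp [A]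

lemma theta_canon_ne {n k l : ℕ} (h : l ≤ n) (f f' : OrderedPairPartition k l) (hne : f' ≠ f) :
    theta f' (canon h f) = 0 := by
  by_contra hcon
  apply hne
  have h1 : ∀ ν, ∃ μ, f'.1 ν = f.1 μ := by
    intro ν
    have h2 := A_ne (Finset.prod_ne_zero_iff.mp hcon ν (Finset.mem_univ ν))
    have hlt := f'.2.1 ν
    obtain ⟨p, hp⟩ := (posEquiv f).surjective (f'.1 ν).1
    obtain ⟨q, hq⟩ := (posEquiv f).surjective (f'.1 ν).2
    rw [← hp, ← hq] at h2 hlt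
    rcases p with p | p <;> rcases q with q | q <;>
      simp only [posEquiv_inl, posEquiv_inr, canon_fst, canon_snd, Sum.swap_inl, Sum.swap_inr,
        reduceCtorEq, Sum.inl.injEq, Sum.inr.injEq] at h2 hlt hp hq
    · have : q = p := Fin.castLE_injective h h2
      subst this
      exact ⟨q, Prod.ext hp.symm hq.symm⟩
    · have : q = p := Fin.castLE_injective h h2
      subst this
      exact absurd hlt (f.2.1 q).asymm
  choose μ hμ using h1
  have hmono : StrictMono μ := by
    intro a b hab
    have h3 := f'.2.2.1 a b hab
    rw [hμ, hμ] at h3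
    by_contra h4
    rcases (not_lt.mp h4).lt_or_eq with h5 | h5
    · exact absurd h3 (f.2.2.1 _ _ h5).asymm
    · rw [h5] at h3; exact lt_irrefl _ h3
  have hid : μ = id := by
    apply (hmono.range_inj strictMono_id).mp
    have : Function.Surjective μ := Finite.surjective_of_injective hmono.injective
    rw [this.range_eq]; simp
  apply Subtype.ext
  funext ν
  rw [hμ, hid]; rfl

/-- flipping the sign of the labels in `B` -/
noncomputable def flipB {n : ℕ} (B : Fin n → Prop) (a : X n) : X n :=
  if B (lab a) then a.swap else a

lemma lab_swap {n : ℕ} (a : X n) : lab a.swap = lab a := by rcases a with a | a <;> rfl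

lemma flipB_inv {n : ℕ} (B : Fin n → Prop) : Function.Involutive (flipB B) := by
  intro a
  unfold flipB
  by_cases h : B (lab a) <;> simp [h, lab_swap]

lemma flip_mem {n : ℕ} (B : Fin n → Prop) :
    mono (flipB_inv B).toPerm (fun b => if B (lab b) ∧ b.isRight then -1 else 1) ∈ Sp n := by
  apply mono_mem
  · intro b
    split_ifs <;> simp
  · rintro (a | a) (b | b) <;>
      simp only [Jmat, Function.Involutive.coe_toPerm, flipB, lab_inl, lab_inr, Sum.swap_inl,
        Sum.swap_inr, Sum.isRight_inl, Sum.isRight_inr, and_true]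
    all_goals
      by_cases hab : a = b
      · subst hab
        by_cases hB : B a <;> simp [hB]
      · by_cases hB : B a <;> by_cases hB' : B b <;> simp [hB, hB', hab]

lemma perm_mem {n : ℕ} (σ : Equiv.Perm (Fin n)) :
    mono (Equiv.sumCongr σ σ) (fun _ => 1) ∈ Sp n := by
  apply mono_mem
  · simp
  · rintro (a | a) (b | b) <;> simp [Jmat, Matrix.one_apply]

lemma exists_partition {n k l : ℕ} (hk : k = 2 * l) (I : Fin k → X n)
    (hI : Function.Injective I) (hs : ∀ j, ∃ j', I j' = (I j).swap) :
    ∃ f : OrderedPairPartition k l, ∀ ν, I (f.1 ν).2 = (I (f.1 ν).1).swap := by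
  choose τ hτ using hs
  have hττ : ∀ j, τ (τ j) = j := fun j => hI (by rw [hτ, hτ, Sum.swap_swap])
  have hne : ∀ j, τ j ≠ j := by
    intro j hj
    have := hτ j
    rw [hj] at this
    rcases h : I j with a | a <;> rw [h] at this <;> simp at this
  set S : Finset (Fin k) := Finset.univ.filter fun j => j < τ j with hSdef
  have hmem : ∀ j, j ∈ S ↔ j < τ j := by simp [hSdef]
  have hmem' : ∀ j, j ∉ S → τ j ∈ S := by
    intro j hj
    rw [hmem] at hj ⊢
    rw [hττ]
    exact lt_of_le_of_ne (not_lt.mp hj) (hne j)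
  have hmem'' : ∀ j, j ∈ S → τ j ∉ S := by
    intro j hj
    rw [hmem] at hj ⊢
    rw [hττ]
    exact hj.asymm
  have hc : S.card = Sᶜ.card := by
    apply Finset.card_nbij' τ τ
    · intro j hj; simpa using hmem'' j (by simpa using hj)
    · intro j hj; simpa using hmem' j (by simpa using hj)
    · intro j _; exact hττ j
    · intro j _; exact hττ j
  have hS : S.card = l := by
    have := Finset.card_add_card_compl S
    rw [Fintype.card_fin] at this
    omega
  set e := S.orderEmbOfFin hS with he
  have heS : ∀ ν, e ν ∈ S := fun ν => Finset.orderEmbOfFin_mem S hS ν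
  have hsurj : ∀ j ∈ S, ∃ ν, e ν = j := by
    intro j hj
    have : j ∈ Set.range e := by rw [he, Finset.range_orderEmbOfFin]; exact hj
    exact this
  refine ⟨⟨fun ν => (e ν, τ (e ν)), ?_, ?_, ?_⟩, ?_⟩
  · intro ν; exact (hmem _).mp (heS ν)
  · intro ν ν' h; exact e.strictMono h
  · intro x
    by_cases hx : x ∈ S
    · obtain ⟨ν, hν⟩ := hsurj x hx
      refine ⟨ν, Or.inl hν.symm, ?_⟩
      rintro ν' (h' | h')
      · exact e.injective (h'.symm.trans hν.symm)
      · simp only at h'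
        exact absurd hx (h' ▸ hmem'' _ (heS ν'))
    · obtain ⟨ν, hν⟩ := hsurj _ (hmem' x hx)
      refine ⟨ν, Or.inr ?_, ?_⟩
      · simp only [hν, hττ]
      rintro ν' (h' | h')
      · simp only at h'
        exact absurd (heS ν') (h' ▸ hx)
      · simp only at h'
        apply e.injective
        rw [hν, h', hττ]
  · intro ν
    exact hτ _

lemma base_case {n k l : ℕ} (hk : k = 2 * l) (hl : l ≤ n) {T : (Fin k → X n) → ℂ} (hT : Inv T)
    (hcan : ∀ f : OrderedPairPartition k l, T (canon hl f) = 0) (I : Fin k → X n)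
    (hI : Function.Injective I) (hs : ∀ j, ∃ j', I j' = (I j).swap) : T I = 0 := by
  obtain ⟨f, hf⟩ := exists_partition hk I hI hs
  have hinj : Function.Injective (fun ν => lab (I (f.1 ν).1)) := by
    intro ν ν' h
    simp only at h
    have : I (f.1 ν).1 = I (f.1 ν').1 ∨ I (f.1 ν).1 = I (f.1 ν').2 := by
      rw [hf ν']
      rcases h1 : I (f.1 ν).1 with a | a <;> rcases h2 : I (f.1 ν').1 with b | b <;>
        rw [h1, h2] at h <;> simp_all
    rcases this with h3 | h3
    · have := (posEquiv f).injective (a₁ := Sum.inl ν) (a₂ := Sum.inl ν') (hI h3)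
      simpa using this
    · have := (posEquiv f).injective (a₁ := Sum.inl ν) (a₂ := Sum.inr ν') (hI h3)
      simp at this
  obtain ⟨σ, hσ⟩ := Equiv.Perm.exists_extending_pair (Fin.castLE hl) _
    (Fin.castLE_injective hl) hinj
  have h1 := hT.mono _ _ (perm_mem σ) (canon hl f)
  rw [hcan, mul_zero] at h1
  set B : Fin n → Prop := fun i => ∃ ν, I (f.1 ν).1 = Sum.inr i with hB
  have h2 := hT.mono _ _ (flip_mem B) (fun j => (Equiv.sumCongr σ σ) (canon hl f j))
  rw [h1, mul_zero] at h2
  rw [← h2]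
  congr 1
  have key : ∀ ν, flipB B (Sum.inl (lab (I (f.1 ν).1))) = I (f.1 ν).1 := by
    intro ν
    rcases h3 : I (f.1 ν).1 with a | a
    · have : ¬ B a := by
        rintro ⟨ν', hν'⟩
        have h4 : I (f.1 ν).2 = I (f.1 ν').1 := by rw [hf, h3, hν']; rfl
        have := (posEquiv f).injective (a₁ := Sum.inr ν) (a₂ := Sum.inl ν') (hI h4)
        simp at this
      simp [flipB, this]
    · have : B a := ⟨ν, h3⟩
      simp [flipB, this]
  have hsw : ∀ a : X n, flipB B a.swap = (flipB B a).swap := by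
    intro a
    simp only [flipB, lab_swap]
    split_ifs <;> rfl
  funext j
  obtain ⟨p, rfl⟩ := (posEquiv f).surjective j
  rcases p with ν | ν
  · simp only [posEquiv_inl, canon_fst, Equiv.sumCongr_apply, Sum.map_inl, hσ,
      Function.Involutive.coe_toPerm]
    exact (key ν).symm
  · simp only [posEquiv_inr, canon_snd, Equiv.sumCongr_apply, Sum.map_inr, hσ,
      Function.Involutive.coe_toPerm]
    rw [hf, ← key ν, ← hsw]
    simp [key ν]

lemma XX_ne {n : ℕ} {i i' : Fin n} {x a : X n} (h : XX i i' x a ≠ 0) :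
    (x = Sum.inl i ∧ a = Sum.inl i') ∨ (x = Sum.inr i ∧ a = Sum.inr i') ∨ lab x = i' := by
  rcases x with x | x <;> rcases a with a | a <;>
    simp [XX, X0, Matrix.single_apply, sub_ne_zero] at h ⊢ <;>
    grind

def used {n k : ℕ} (I : Fin k → X n) : Finset (Fin n) := Finset.univ.image fun j => lab (I j)

lemma vanish {n k l : ℕ} (hk : k = 2 * l) (hl : l ≤ n) {T : (Fin k → X n) → ℂ} (hT : Inv T)
    (hcan : ∀ f : OrderedPairPartition k l, T (canon hl f) = 0) :
    ∀ d : ℕ, ∀ I : Fin k → X n, n - (used I).card = d → T I = 0 := by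
  intro d
  induction d using Nat.strong_induction_on with
  | _ d ih =>
  intro I hd
  by_contra hTI
  have hbal : ∀ i, cnt I (Sum.inl i) = cnt I (Sum.inr i) := fun i => by
    by_contra h; exact hTI (hT.balanced I i h)
  have hpos : ∀ j, 0 < cnt I (I j) := fun j =>
    Finset.card_pos.mpr ⟨j, by simp⟩
  have hpos' : ∀ a, 0 < cnt I a → ∃ j, I j = a := by
    intro a ha
    obtain ⟨j, hj⟩ := Finset.card_pos.mp ha
    exact ⟨j, by simpa using hj⟩
  by_cases hmf : ∀ i, cnt I (Sum.inl i) ≤ 1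
  · apply hTI
    apply base_case hk hl hT hcan I
    · intro j j' hjj
      have h1 : cnt I (I j) ≤ 1 := by
        rcases h : I j with a | a
        · exact hmf a
        · rw [← hbal]; exact hmf a
      exact Finset.card_le_one.mp h1 j (by simp) j' (by simp [hjj])
    · intro j
      apply hpos'
      have := hpos j
      rcases h : I j with a | a <;> rw [h] at this
      · rw [Sum.swap_inl, ← hbal]; exact this
      · rw [Sum.swap_inr, hbal]; exact this
  · push Not at hmf
    obtain ⟨i, hi⟩ := hmf
    have hun : ∃ i', ∀ j, lab (I j) ≠ i' := by
      by_contra hcon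
      push Not at hcon
      have h1 : ∀ i, 1 ≤ cnt I (Sum.inl i) := by
        intro i
        obtain ⟨j, hj⟩ := hcon i
        have := hpos j
        rcases h : I j with a | a <;> rw [h] at this hj <;> simp only [lab_inl, lab_inr] at hj <;>
          subst hj
        · exact this
        · rw [hbal]; exact this
      have h2 : ∑ i : Fin n, 1 < ∑ i : Fin n, cnt I (Sum.inl i) :=
        Finset.sum_lt_sum (fun i _ => h1 i) ⟨i, Finset.mem_univ _, hi⟩
      have h3 : k = ∑ a : X n, cnt I a := by
        have := Finset.card_eq_sum_card_fiberwise (f := I) (s := Finset.univ) (t := Finset.univ)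
          (by intro x _; simp)
        simpa [cnt] using this
      rw [Fintype.sum_sum_type] at h3
      simp_rw [← hbal] at h3
      simp at h2
      omega
    obtain ⟨i', hi'⟩ := hun
    obtain ⟨j0, hj0⟩ := hpos' (Sum.inr i) (by rw [← hbal]; omega)
    have hii : i ≠ i' := by
      intro h
      exact hi' j0 (by rw [hj0, ← h]; rfl)
    set J := Function.update I j0 (Sum.inr i') with hJ
    have hlie := hT.lie hii J
    have hterm : ∀ j, ∑ a, XX i i' (J j) a * T (Function.update J j a)
        = if j = j0 then - T I else 0 := by
      intro j
      split_ifs with hj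
      · subst hj
        rw [Finset.sum_eq_single (Sum.inr i)]
        · have h1 : Function.update J j (Sum.inr i) = I := by
            rw [hJ, Function.update_idem, ← hj0, Function.update_eq_self]
          rw [h1]
          simp [hJ, XX, X0, hii]
        · intro a _ ha
          rcases a with a | a
          · simp [hJ, XX]
          · have : i ≠ a := fun h => ha (by rw [h])
            simp [hJ, XX, X0, hii, this]
        · simp
      · apply Finset.sum_eq_zero
        intro a _
        by_contra hne
        have hJj : J j = I j := Function.update_of_ne hj _ _
        rw [hJj] at hne
        rcases XX_ne (left_ne_zero_of_mul hne) with ⟨h1, h2⟩ | ⟨h1, h2⟩ | h1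
        · apply right_ne_zero_of_mul hne
          rw [h2]
          have hsub : used I ⊂ used (Function.update J j (Sum.inl i')) := by
            rw [Finset.ssubset_iff_of_subset]
            · refine ⟨i', ?_, ?_⟩
              · simp only [used, Finset.mem_image, Finset.mem_univ, true_and]
                exact ⟨j, by simp⟩
              · simp only [used, Finset.mem_image, Finset.mem_univ, true_and, not_exists]
                exact hi'
            · intro x hx
              simp only [used, Finset.mem_image, Finset.mem_univ, true_and] at hx ⊢
              obtain ⟨j1, hj1⟩ := hx
              by_cases hxi : x = i
              · obtain ⟨j2, hj2, hj2'⟩ := Finset.exists_mem_ne hi j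
                have h3 : I j2 = Sum.inl i := by simpa using hj2
                have h4 : j2 ≠ j0 := by
                  intro h; rw [h, hj0] at h3; simp at h3
                refine ⟨j2, ?_⟩
                rw [Function.update_of_ne hj2', hJ, Function.update_of_ne h4, h3, hxi]; rfl
              · have h3 : j1 ≠ j := by
                  intro h; rw [h, h1] at hj1; exact hxi hj1.symm
                have h4 : j1 ≠ j0 := by
                  intro h; rw [h, hj0] at hj1; exact hxi hj1.symm
                refine ⟨j1, ?_⟩
                rw [Function.update_of_ne h3, hJ, Function.update_of_ne h4, hj1]
          have hlt := Finset.card_lt_card hsub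
          have hle := Finset.card_le_univ (used (Function.update J j (Sum.inl i')))
          rw [Fintype.card_fin] at hle
          exact ih _ (by omega) _ rfl
        · apply right_ne_zero_of_mul hne
          rw [h2]
          apply hT.balanced _ i'
          have hz : cnt (Function.update J j (Sum.inr i')) (Sum.inl i') = 0 := by
            apply Finset.card_eq_zero.mpr
            apply Finset.filter_eq_empty_iff.mpr
            intro j1 _ h3
            by_cases h4 : j1 = j
            · subst h4; simp at h3
            · rw [Function.update_of_ne h4] at h3
              by_cases h5 : j1 = j0
              · subst h5; simp [hJ] at h3
              · rw [hJ, Function.update_of_ne h5] at h3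
                exact hi' j1 (by rw [h3]; rfl)
          have hp : 0 < cnt (Function.update J j (Sum.inr i')) (Sum.inr i') :=
            Finset.card_pos.mpr ⟨j, by simp⟩
          omega
        · exact hi' j h1
    simp_rw [hterm] at hlie
    simp at hlie
    exact hTI hlie

lemma vanish' {n k l : ℕ} (hk : k = 2 * l) (hl : l ≤ n) {T : (Fin k → X n) → ℂ} (hT : Inv T)
    (hcan : ∀ f : OrderedPairPartition k l, T (canon hl f) = 0) (I : Fin k → X n) : T I = 0 :=
  vanish hk hl hT hcan _ I rfl

/-- First fundamental theorem in the stable range. -/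
lemma fft {n k l : ℕ} (hk : k = 2 * l) (hl : l ≤ n) {T : (Fin k → X n) → ℂ} (hT : Inv T)
    (I : Fin k → X n) :
    T I = ∑ f : OrderedPairPartition k l, T (canon hl f) * theta f I := by
  have h : Inv (fun I => T I - ∑ f : OrderedPairPartition k l, T (canon hl f) * theta f I) := by
    intro h hh J
    simp only [mul_sub, Finset.sum_sub_distrib, Finset.mul_sum]
    rw [hT h hh J, Finset.sum_comm]
    congr 1
    refine Finset.sum_congr rfl fun f _ => ?_
    rw [← theta_inv f h hh J, Finset.mul_sum]
    refine Finset.sum_congr rfl fun K _ => ?_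
    ring
  have := vanish' hk hl h ?_ I
  · exact sub_eq_zero.mp this
  · intro f
    rw [Finset.sum_eq_single f]
    · rw [theta_canon_self]; simp
    · intro f' _ hf'
      rw [theta_canon_ne hl f f' hf', mul_zero]
    · simp

end SpW

namespace SpW

lemma vvec_fst {n k l : ℕ} (f : OrderedPairPartition k l) (η : Fin l → Fin n) (ε : Fin l → Fin 2)
    (ν : Fin l) : vvec n k l f.1 η ε (f.1 ν).1 =
      (Pi.single (idx n (η ν) (ε ν)) 1 : X n → ℂ) := by
  have h : ∃ ν', (f.1 ν').1 = (f.1 ν).1 := ⟨ν, rfl⟩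
  have h1 : h.choose = ν := by
    have := (posEquiv f).injective (a₁ := Sum.inl h.choose) (a₂ := Sum.inl ν) h.choose_spec
    simpa using this
  rw [vvec, dif_pos h, h1]

lemma vvec_snd {n k l : ℕ} (f : OrderedPairPartition k l) (η : Fin l → Fin n) (ε : Fin l → Fin 2)
    (ν : Fin l) : vvec n k l f.1 η ε (f.1 ν).2 =
      ((-1 : ℂ) ^ ((ε ν : ℕ))) • (Pi.single (idx n (η ν) (1 - ε ν)) 1 : X n → ℂ) := by
  have h0 : ¬ ∃ ν', (f.1 ν').1 = (f.1 ν).2 := by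
    rintro ⟨ν', h⟩
    have := (posEquiv f).injective (a₁ := Sum.inl ν') (a₂ := Sum.inr ν) h
    simp at this
  have h : ∃ ν', (f.1 ν').2 = (f.1 ν).2 := ⟨ν, rfl⟩
  have h1 : h.choose = ν := by
    have := (posEquiv f).injective (a₁ := Sum.inr h.choose) (a₂ := Sum.inr ν) h.choose_spec
    simpa using this
  rw [vvec, dif_neg h0, dif_pos h, h1]

lemma pair_sum {n : ℕ} (a b : X n) :
    ∑ i : Fin n, ∑ s : Fin 2, (Pi.single (idx n i s) 1 : X n → ℂ) a *
      (((-1 : ℂ) ^ ((s : ℕ))) • (Pi.single (idx n i (1 - s)) 1 : X n → ℂ)) b = A n a b := by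
  simp only [Fin.sum_univ_two]
  rcases a with a | a <;> rcases b with b | b <;>
    simp [idx, A, Pi.single_apply, Matrix.one_apply, Finset.sum_add_distrib, eq_comm]

lemma theta_eq {n k l : ℕ} (f : OrderedPairPartition k l) (I : Fin k → X n) :
    ∑ η : Fin l → Fin n, ∑ ε : Fin l → Fin 2, ∏ j, vvec n k l f.1 η ε j (I j) = theta f I := by
  unfold theta
  simp_rw [← pair_sum, prod_sum_fun, prod_split f, vvec_fst, vvec_snd]

/-- sign of an index -/
def sg {n : ℕ} (a : X n) : ℂ := Sum.elim (fun _ => 1) (fun _ => -1) a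

lemma aForm_eq {n : ℕ} (v w : X n → ℂ) : aForm n v w = ∑ a, v a * (sg a * w a.swap) := by
  simp [aForm, sg, Fintype.sum_sum_type, Finset.sum_add_distrib, sub_eq_add_neg]

lemma sg_A {n : ℕ} (a b : X n) : sg a * sg b * A n a.swap b.swap = A n a b := by
  rcases a with a | a <;> rcases b with b | b <;> simp [sg, A]

lemma theta_swap {n k l : ℕ} (f : OrderedPairPartition k l) (I : Fin k → X n) :
    (∏ j, sg (I j)) * theta f (fun j => (I j).swap) = theta f I := by
  unfold theta
  rw [prod_split f, ← Finset.prod_mul_distrib]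
  refine Finset.prod_congr rfl fun ν _ => sg_A _ _

lemma gram_eq {n k l : ℕ} (f f' : OrderedPairPartition k l) :
    gramSp n k l f f' = ∑ I : Fin k → X n, theta f I * theta f' I := by
  have h : ∀ η ε η' ε', ∏ j : Fin k, aForm n (vvec n k l f.1 η ε j) (vvec n k l f'.1 η' ε' j)
      = ∑ I : Fin k → X n, (∏ j, vvec n k l f.1 η ε j (I j)) * ((∏ j, sg (I j)) *
          ∏ j, vvec n k l f'.1 η' ε' j (I j).swap) := by
    intro η ε η' ε'
    simp_rw [aForm_eq, prod_sum_fun, Finset.prod_mul_distrib]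
  have h2 : ∀ I : Fin k → X n, theta f I * theta f' I =
      ∑ η : Fin l → Fin n, ∑ ε : Fin l → Fin 2, ∑ η' : Fin l → Fin n, ∑ ε' : Fin l → Fin 2,
        (∏ j, vvec n k l f.1 η ε j (I j)) * ((∏ j, sg (I j)) *
          ∏ j, vvec n k l f'.1 η' ε' j (I j).swap) := by
    intro I
    rw [← theta_swap f' I, ← theta_eq f I, ← theta_eq f']
    simp_rw [Finset.sum_mul, Finset.mul_sum]
  unfold gramSp
  simp_rw [h, h2]
  symm
  rw [Finset.sum_comm]
  refine Finset.sum_congr rfl fun η _ => ?_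
  rw [Finset.sum_comm]
  refine Finset.sum_congr rfl fun ε _ => ?_
  rw [Finset.sum_comm]
  refine Finset.sum_congr rfl fun η' _ => ?_
  rw [Finset.sum_comm]

/-- matrix of the coefficients -/
noncomputable def M (n k l : ℕ) : Matrix (Fin k → X n) (OrderedPairPartition k l) ℂ :=
  fun I f => theta f I

lemma A_star {n : ℕ} (a b : X n) : star (A n a b) = A n a b := by
  rcases a with a | a <;> rcases b with b | b <;> simp [A, Matrix.one_apply, apply_ite]

lemma gram_mat (n k l : ℕ) : gramSp n k l = (M n k l)ᴴ * M n k l := by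
  ext f f'
  rw [gram_eq]
  simp only [Matrix.mul_apply, Matrix.conjTranspose_apply, M]
  refine Finset.sum_congr rfl fun I _ => ?_
  congr 1
  simp only [theta, star_prod, A_star]

open scoped ComplexOrder in
lemma gram_isUnit {n k l : ℕ} (hl : l ≤ n) : IsUnit (gramSp n k l).det := by
  rw [gram_mat, ← Matrix.isUnit_iff_isUnit_det]
  apply Matrix.PosDef.isUnit
  apply Matrix.PosDef.conjTranspose_mul_self
  rw [← Matrix.coe_mulVecLin, injective_iff_map_eq_zero]
  intro x hx
  funext f
  have h := congrFun hx (canon hl f)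
  simp only [Matrix.mulVecLin_apply, Matrix.mulVec, dotProduct, M, Pi.zero_apply] at h
  rw [Finset.sum_eq_single f] at h
  · simpa [theta_canon_self] using h
  · intro f' _ hf'
    rw [theta_canon_ne hl f f' hf', zero_mul]
  · simp

lemma meas_entry {n : ℕ} (a b : X n) : Measurable (fun g : Matrix (X n) (X n) ℂ => g a b) :=
  (measurable_pi_apply b).comp (measurable_pi_apply (X := fun _ : X n => X n → ℂ) a)

lemma meas_prod {n k : ℕ} (I K : Fin k → X n) :
    Measurable (fun g : Matrix (X n) (X n) ℂ => ∏ j, g (I j) (K j)) :=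
  Finset.measurable_fun_prod _ fun j _ => meas_entry _ _

lemma meas_mul {n : ℕ} (h : Matrix (X n) (X n) ℂ) :
    Measurable (fun g : Matrix (X n) (X n) ℂ => h * g) := by
  refine measurable_pi_lambda _ fun a => measurable_pi_lambda _ fun b => ?_
  simp only [Matrix.mul_apply]
  exact Finset.measurable_fun_sum _ fun c _ => (meas_entry c b).const_mul _

section integral

lemma integrable_prod {n k : ℕ} (μ : Measure (Matrix (X n) (X n) ℂ)) (hprob : IsProbabilityMeasure μ)
    (hsupp : ∀ᵐ g ∂ μ, g ∈ Sp n) (I K : Fin k → X n) :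
    Integrable (fun g : Matrix (X n) (X n) ℂ => ∏ j, g (I j) (K j)) μ := by
  refine Integrable.of_bound (meas_prod I K).aestronglyMeasurable 1 ?_
  filter_upwards [hsupp] with g hg
  rw [norm_prod]
  refine Finset.prod_le_one (fun _ _ => norm_nonneg _) fun j _ => ?_
  exact entry_norm_bound_of_unitary hg.1 _ _

lemma int_inv {n k : ℕ} (μ : Measure (Matrix (X n) (X n) ℂ)) (hprob : IsProbabilityMeasure μ)
    (hsupp : ∀ᵐ g ∂ μ, g ∈ Sp n) (hinv : ∀ h ∈ Sp n, μ.map (fun g => h * g) = μ)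
    (K : Fin k → X n) : Inv (fun I => ∫ g, ∏ j, g (I j) (K j) ∂ μ) := by
  intro h hh J
  simp only
  conv_rhs => rw [← hinv h hh]
  rw [integral_map (meas_mul h).aemeasurable (meas_prod J K).aestronglyMeasurable]
  simp_rw [← integral_const_mul]
  rw [← integral_finsetSum]
  · congr 1
    funext g
    simp only [Matrix.mul_apply]
    rw [prod_sum_fun]
    simp_rw [Finset.prod_mul_distrib]
  · intro I _
    exact (integrable_prod μ hprob hsupp I K).const_mul _

lemma int_formula {n k l : ℕ} (hk : k = 2 * l) (hl : l ≤ n)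
    (μ : Measure (Matrix (X n) (X n) ℂ)) (hprob : IsProbabilityMeasure μ)
    (hsupp : ∀ᵐ g ∂ μ, g ∈ Sp n) (hinv : ∀ h ∈ Sp n, μ.map (fun g => h * g) = μ)
    (I K : Fin k → X n) :
    ∫ g, ∏ j, g (I j) (K j) ∂ μ = ∑ f : OrderedPairPartition k l, ∑ f' : OrderedPairPartition k l,
      (gramSp n k l)⁻¹ f f' * theta f I * theta f' K := by
  set c : OrderedPairPartition k l → ℂ := fun f => ∫ g, ∏ j, g (canon hl f j) (K j) ∂ μ with hc
  have h1 : ∀ I, ∫ g, ∏ j, g (I j) (K j) ∂ μ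
      = ∑ f : OrderedPairPartition k l, c f * theta f I := by
    intro I
    exact fft hk hl (int_inv μ hprob hsupp hinv K) I
  have h2 : (gramSp n k l) *ᵥ c = fun f => theta f K := by
    funext f'
    have h3 : ∑ I : Fin k → X n, theta f' I * ∫ g, ∏ j, g (I j) (K j) ∂ μ = theta f' K := by
      simp_rw [← integral_const_mul]
      rw [← integral_finsetSum]
      · have : ∀ᵐ g ∂ μ, ∑ I : Fin k → X n, theta f' I * ∏ j, g (I j) (K j) = theta f' K := by
          filter_upwards [hsupp] with g hg
          exact theta_inv' f' hg K
        rw [integral_congr_ae this]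
        simp
      · intro I _
        exact (integrable_prod μ hprob hsupp I K).const_mul _
    rw [← h3]
    simp_rw [h1]
    simp only [Matrix.mulVec, dotProduct, gram_eq, Finset.sum_mul, Finset.mul_sum]
    rw [Finset.sum_comm]
    refine Finset.sum_congr rfl fun I _ => Finset.sum_congr rfl fun f _ => ?_
    ring
  have h4 : c = (gramSp n k l)⁻¹ *ᵥ fun f => theta f K := by
    rw [← h2, Matrix.mulVec_mulVec, Matrix.nonsing_inv_mul _ (gram_isUnit hl), Matrix.one_mulVec]
  rw [h1, h4]
  simp only [Matrix.mulVec, dotProduct, Finset.sum_mul]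
  refine Finset.sum_congr rfl fun f _ => Finset.sum_congr rfl fun f' _ => ?_
  ring

end integral

lemma A_idx {n : ℕ} (i i' : Fin n) (s s' : Fin 2) :
    A n (idx n i s) (idx n i' s') =
      (-1) * ((if s = 0 then (-1 : ℂ) else 1) * (if i = i' ∧ s ≠ s' then 1 else 0)) := by
  fin_cases s <;> fin_cases s' <;> simp [idx, A, Matrix.one_apply, apply_ite (Neg.neg : ℂ → ℂ)]

lemma theta_idx {n k l : ℕ} (f : OrderedPairPartition k l) (φ : Fin k → Fin n) (α : Fin k → Fin 2) :
    theta f (fun j => idx n (φ j) (α j)) = (-1) ^ l *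
      ((-1 : ℂ) ^ (Finset.univ.filter fun ν => α (f.1 ν).1 = 0).card *
        (if MemF f.1 φ α then (1 : ℂ) else 0)) := by
  unfold theta
  simp_rw [A_idx]
  rw [Finset.prod_mul_distrib, Finset.prod_mul_distrib]
  congr 1
  · simp
  · congr 1
    · rw [Finset.prod_ite]; simp
    · rw [Finset.prod_ite_zero]
      by_cases hm : MemF f.1 φ α
      · rw [if_pos hm, if_pos (fun ν _ => hm ν)]; simp
      · rw [if_neg hm, if_neg (fun h => hm fun ν => h ν (Finset.mem_univ ν))]

end SpW

/-- The symplectic Weingarten integration formula: for Haar measure on `Sp(2n)`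
the integral of `∏ⱼ g_{φ(j)+nα(j), ψ(j)+nβ(j)}` vanishes for odd `k`, while for
`k = 2l` with `n ≥ l` the Gram matrix `(a(θ_{m°}, θ_{n°}))` is invertible and
the integral is given by the signed Weingarten sum over ordered pair partitions. -/
theorem weingarten_symplectic
    (n k : ℕ) (φ ψ : Fin k → Fin n) (α β : Fin k → Fin 2)
    (μ : Measure (Matrix (Fin n ⊕ Fin n) (Fin n ⊕ Fin n) ℂ))
    (hprob : IsProbabilityMeasure μ)
    (hsupp : ∀ᵐ g ∂ μ, g ∈ Sp n)
    (hinv : ∀ h ∈ Sp n, μ.map (fun g => h * g) = μ) :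
    (Odd k →
      (∫ g, ∏ j, g (idx n (φ j) (α j)) (idx n (ψ j) (β j)) ∂ μ) = 0) ∧
    (∀ l : ℕ, k = 2 * l → l ≤ n →
      IsUnit (gramSp n k l).det ∧
      (∫ g, ∏ j, g (idx n (φ j) (α j)) (idx n (ψ j) (β j)) ∂ μ) =
        ∑ f : OrderedPairPartition k l, ∑ f' : OrderedPairPartition k l,
          (gramSp n k l)⁻¹ f f' *
          ((-1 : ℂ) ^ ((Finset.univ.filter fun ν => α (f.1 ν).1 = 0).card
            + (Finset.univ.filter fun ν => β (f'.1 ν).1 = 0).card)) *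
          (if MemF f.1 φ α then (1 : ℂ) else 0) *
          (if MemF f'.1 ψ β then (1 : ℂ) else 0)) := by
  refine ⟨fun hodd => ?_, fun l hk hl => ⟨SpW.gram_isUnit hl, ?_⟩⟩
  · have h := (SpW.int_inv μ hprob hsupp hinv (fun j => idx n (ψ j) (β j))).mono (Equiv.refl _)
      (fun _ => -1) (SpW.mono_mem _ _ (by simp) (by simp)) (fun j => idx n (φ j) (α j))
    simp only [Equiv.refl_apply, Finset.prod_const, Finset.card_univ, Fintype.card_fin,
      hodd.neg_one_pow] at h
    linear_combination h / 2
  · rw [SpW.int_formula hk hl μ hprob hsupp hinv (fun j => idx n (φ j) (α j))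
      (fun j => idx n (ψ j) (β j))]
    refine Finset.sum_congr rfl fun f _ => Finset.sum_congr rfl fun f' _ => ?_
    rw [SpW.theta_idx, SpW.theta_idx, pow_add]
    have h1 : ((-1 : ℂ) ^ l) * (-1) ^ l = 1 := by
      rw [← mul_pow]; simp
    linear_combination ((gramSp n k l)⁻¹ f f' *
      ((-1 : ℂ) ^ (Finset.univ.filter fun ν => α (f.1 ν).1 = 0).card *
      (-1 : ℂ) ^ (Finset.univ.filter fun ν => β (f'.1 ν).1 = 0).card) *
          (if MemF f.1 φ α then (1 : ℂ) else 0) *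
          (if MemF f'.1 ψ β then (1 : ℂ) else 0)) * h1
end

section
/- Let k, N ∈ ℕ with N ≥ k and let φ, ψ, φ', ψ' : {1,…,k} → {1,…,N}. Then the function σ ↦ N^{#cycles(σ)} on the symmetric group S_k has an inverse Wg for the convolution product on S_k (i.e., Σ_{τ ∈ S_k} N^{#cycles(τ)} · Wg(τ^{−1}σ) = 1 if σ = id and = 0 otherwise), and ∫_{U(N)} ∏_{j=1}^k u_{φ(j),ψ(j)} · conj(u_{φ'(j),ψ'(j)}) dλ(u) = Σ_{σ, τ ∈ S_k} 1[φ(j) = φ'(σ(j)) for all j] · 1[ψ(j) = ψ'(τ(j)) for all j] · Wg(τσ^{−1}). -/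
open MeasureTheory Matrix

/-- The number of cycles of a permutation of `{1,…,k}`, counting fixed points
as cycles. -/
def cycleCount {k : ℕ} (σ : Equiv.Perm (Fin k)) : ℕ :=
  σ.cycleType.card + (k - σ.support.card)


section Helpers

open Equiv

/-- Functions invariant under `σ` are counted by the cycles of `σ`. -/
lemma wg_card_fixed {k N : ℕ} (σ : Perm (Fin k)) :
    Fintype.card {f : Fin k → Fin N // f ∘ σ = f} = N ^ cycleCount σ := by
  classical
  let C := (σ.cycleFactorsFinset : Finset _) ⊕ ((σ.support)ᶜ : Finset (Fin k))
  let p : Fin k → C := fun x =>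
    if h : x ∈ σ.support then
      Sum.inl ⟨σ.cycleOf x, Perm.cycleOf_mem_cycleFactorsFinset_iff.2 h⟩
    else Sum.inr ⟨x, by simpa using h⟩
  have hp : Function.Surjective p := by
    rintro (⟨c, hc⟩ | ⟨x, hx⟩)
    · obtain ⟨x, hx, -⟩ := (Perm.mem_cycleFactorsFinset_iff.1 hc).1
      have hx' : x ∈ c.support := by simpa using hx
      have h1 := Perm.cycle_is_cycleOf hx' hc
      have h2 : x ∈ σ.support := by
        rw [← Perm.cycleOf_mem_cycleFactorsFinset_iff, ← h1]; exact hc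
      exact ⟨x, by simp only [p, dif_pos h2, ← h1]⟩
    · have h2 : x ∉ σ.support := by simpa using hx
      exact ⟨x, by simp only [p, dif_neg h2]⟩
  have hpσ : ∀ x, p (σ x) = p x := by
    intro x
    by_cases h : x ∈ σ.support
    · have h' : σ x ∈ σ.support := Perm.apply_mem_support.2 h
      have : σ.cycleOf (σ x) = σ.cycleOf x :=
        ((Perm.sameCycle_iff_cycleOf_eq_of_mem_support h' h).1
          (Perm.sameCycle_apply_left.2 (Perm.SameCycle.refl _ _)))
      simp only [p, dif_pos h, dif_pos h', this]
    · have : σ x = x := by simpa using h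
      rw [this]
  have hpe : ∀ x y, p x = p y → σ.SameCycle x y := by
    intro x y hxy
    by_cases h : x ∈ σ.support <;> by_cases h' : y ∈ σ.support
    · simp only [p, dif_pos h, dif_pos h'] at hxy
      exact (Perm.sameCycle_iff_cycleOf_eq_of_mem_support h h').2
        (congrArg Subtype.val (Sum.inl.inj hxy))
    · simp only [p, dif_pos h, dif_neg h'] at hxy
      exact absurd hxy Sum.inl_ne_inr
    · simp only [p, dif_neg h, dif_pos h'] at hxy
      exact absurd hxy Sum.inr_ne_inl
    · simp only [p, dif_neg h, dif_neg h'] at hxy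
      have hxy' : x = y := congrArg Subtype.val (Sum.inr.inj hxy)
      rw [hxy']
  let e : (C → Fin N) → {f : Fin k → Fin N // f ∘ σ = f} := fun g =>
    ⟨g ∘ p, by funext x; simp [hpσ]⟩
  have he : Function.Bijective e := by
    constructor
    · intro g g' h
      have h1 : g ∘ p = g' ∘ p := congrArg Subtype.val h
      exact hp.injective_comp_right h1
    · rintro ⟨f, hf⟩
      have hz : ∀ x y, σ.SameCycle x y → f x = f y := by
        rintro x y ⟨n, rfl⟩
        have h1 : ∀ x, f (σ x) = f x := fun x => congrFun hf x
        have h2 : ∀ x, f (σ⁻¹ x) = f x := fun x => by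
          rw [← h1 (σ⁻¹ x)]; simp
        induction n using Int.induction_on with
        | zero => simp
        | succ n ih => rw [add_comm, _root_.zpow_add, zpow_one, Perm.mul_apply, h1, ← ih]
        | pred n ih => rw [sub_eq_neg_add, _root_.zpow_add, _root_.zpow_neg_one, Perm.mul_apply, h2, ← ih]
      refine ⟨fun c => f (hp c).choose, ?_⟩
      apply Subtype.ext
      funext x
      exact hz _ _ (hpe _ _ (hp (p x)).choose_spec)
  rw [← Fintype.card_of_bijective he]
  simp only [Fintype.card_fun, Fintype.card_fin, C, Fintype.card_sum, Fintype.card_coe]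
  congr 1
  rw [cycleCount, Perm.cycleType_def, Multiset.card_map, Finset.card_compl, Fintype.card_fin]
  rfl

lemma wg_cycleCount_inv {k : ℕ} (σ : Perm (Fin k)) : cycleCount σ⁻¹ = cycleCount σ := by
  simp [cycleCount]

lemma wg_cycleCount_comm {k : ℕ} (σ τ : Perm (Fin k)) :
    cycleCount (σ * τ) = cycleCount (τ * σ) := by
  have : σ * τ = σ * (τ * σ) * σ⁻¹ := by group
  rw [this, cycleCount, Perm.cycleType_conj, Perm.card_support_conj, cycleCount]

/-- the tensor power of a matrix -/
def wgT (k : ℕ) {N : ℕ} (A : Matrix (Fin N) (Fin N) ℂ) :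
    Matrix (Fin k → Fin N) (Fin k → Fin N) ℂ :=
  fun φ ψ => ∏ j, A (φ j) (ψ j)

lemma wgT_mul (k : ℕ) {N : ℕ} (A B : Matrix (Fin N) (Fin N) ℂ) :
    wgT k (A * B) = wgT k A * wgT k B := by
  ext φ ψ
  simp only [wgT, Matrix.mul_apply]
  rw [Fintype.prod_sum]
  simp only [Finset.prod_mul_distrib]

lemma wgT_one (k N : ℕ) : wgT k (1 : Matrix (Fin N) (Fin N) ℂ) = 1 := by
  ext φ ψ
  simp only [wgT, Matrix.one_apply, Finset.prod_boole, funext_iff]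
  simp

lemma wgT_conjTranspose (k : ℕ) {N : ℕ} (A : Matrix (Fin N) (Fin N) ℂ) :
    wgT k (Aᴴ) = (wgT k A)ᴴ := by
  ext φ ψ
  simp [wgT, Matrix.conjTranspose_apply]

/-- Two functions with the same weight differ by a permutation. -/
lemma wg_weight {k N : ℕ} (φ ψ : Fin k → Fin N)
    (h : ∀ d : Fin N → ℂ, (∀ a, ‖d a‖ = 1) → ∏ j, d (φ j) = ∏ j, d (ψ j)) :
    ∃ σ : Perm (Fin k), φ = ψ ∘ σ := by
  classical
  have hz := Complex.isPrimitiveRoot_exp (k + 1) (by omega)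
  set ζ := Complex.exp (2 * Real.pi * Complex.I / ((k + 1 : ℕ) : ℂ)) with hζ
  have hn : ‖ζ‖ = 1 := hz.norm'_eq_one (by omega)
  have key : ∀ b, Fintype.card {a // φ a = b} = Fintype.card {a // ψ a = b} := by
    intro b
    have h1 := h (fun a => if a = b then ζ else 1) (by intro a; split_ifs <;> simp [hn])
    simp only [Finset.prod_ite, Finset.prod_const, one_pow, mul_one] at h1
    rw [Fintype.card_subtype, Fintype.card_subtype]
    refine hz.pow_inj ?_ ?_ h1
    · exact Nat.lt_succ_of_le ((Finset.card_le_univ _).trans (by simp))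
    · exact Nat.lt_succ_of_le ((Finset.card_le_univ _).trans (by simp))
  refine ⟨Equiv.ofFiberEquiv (f := φ) (g := ψ) (fun c => Fintype.equivOfCardEq (key c)), ?_⟩
  funext a
  exact (Equiv.ofFiberEquiv_map _ a).symm

lemma wg_diag_unitary {N : ℕ} (d : Fin N → ℂ) (hd : ∀ a, ‖d a‖ = 1) :
    Matrix.diagonal d ∈ Matrix.unitaryGroup (Fin N) ℂ := by
  rw [Matrix.mem_unitaryGroup_iff, Matrix.star_eq_conjTranspose, Matrix.diagonal_conjTranspose,
    Matrix.diagonal_mul_diagonal, ← Matrix.diagonal_one]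
  congr 1
  funext a
  simp [Complex.mul_conj, Complex.normSq_eq_norm_sq, hd]

lemma wgT_diagonal (k : ℕ) {N : ℕ} (d : Fin N → ℂ) :
    wgT k (Matrix.diagonal d) = Matrix.diagonal (fun φ => ∏ j, d (φ j)) := by
  ext φ ψ
  by_cases h : φ = ψ
  · subst h; simp [wgT]
  · rw [Matrix.diagonal_apply_ne _ h]
    obtain ⟨j, hj⟩ := Function.ne_iff.1 h
    exact Finset.prod_eq_zero (Finset.mem_univ j) (Matrix.diagonal_apply_ne _ hj)

lemma wg_support {k N : ℕ} (M : Matrix (Fin k → Fin N) (Fin k → Fin N) ℂ)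
    (hM : ∀ u ∈ Matrix.unitaryGroup (Fin N) ℂ, M * wgT k u = wgT k u * M)
    (φ ψ : Fin k → Fin N) (h0 : M φ ψ ≠ 0) : ∃ σ : Perm (Fin k), φ = ψ ∘ σ := by
  apply wg_weight
  intro d hd
  have := congrFun (congrFun (hM _ (wg_diag_unitary d hd)) φ) ψ
  rw [wgT_diagonal, Matrix.mul_diagonal, Matrix.diagonal_mul, mul_comm] at this
  exact (mul_right_cancel₀ h0 this).symm

lemma wg_comm_diag {k N : ℕ} (M : Matrix (Fin k → Fin N) (Fin k → Fin N) ℂ)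
    (hM : ∀ u ∈ Matrix.unitaryGroup (Fin N) ℂ, M * wgT k u = wgT k u * M) (d : Fin N → ℂ) :
    M * wgT k (Matrix.diagonal d) = wgT k (Matrix.diagonal d) * M := by
  ext φ ψ
  rw [wgT_diagonal, Matrix.mul_diagonal, Matrix.diagonal_mul, mul_comm]
  by_cases h0 : M φ ψ = 0
  · simp [h0]
  obtain ⟨σ, rfl⟩ := wg_support M hM φ ψ h0
  congr 1
  exact (Equiv.prod_comp σ (fun j => d (ψ j))).symm

lemma wg_comm_herm {k N : ℕ} (M : Matrix (Fin k → Fin N) (Fin k → Fin N) ℂ)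
    (hM : ∀ u ∈ Matrix.unitaryGroup (Fin N) ℂ, M * wgT k u = wgT k u * M)
    (A : Matrix (Fin N) (Fin N) ℂ) (hA : A.IsHermitian) :
    M * wgT k A = wgT k A * M := by
  rw [hA.spectral_theorem, Unitary.conjStarAlgAut_apply, wgT_mul, wgT_mul,
    ← Matrix.mul_assoc, ← Matrix.mul_assoc, hM _ hA.eigenvectorUnitary.2,
    Matrix.mul_assoc (wgT k _) M, wg_comm_diag M hM, Matrix.mul_assoc, Matrix.mul_assoc,
    hM (star (hA.eigenvectorUnitary : Matrix (Fin N) (Fin N) ℂ))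
      (star hA.eigenvectorUnitary).2]
  simp only [Matrix.mul_assoc]

lemma wg_comm_all {k N : ℕ} (M : Matrix (Fin k → Fin N) (Fin k → Fin N) ℂ)
    (hM : ∀ u ∈ Matrix.unitaryGroup (Fin N) ℂ, M * wgT k u = wgT k u * M)
    (A : Matrix (Fin N) (Fin N) ℂ) :
    M * wgT k A = wgT k A * M := by
  let H : Matrix (Fin N) (Fin N) ℂ := (realPart A : Matrix (Fin N) (Fin N) ℂ)
  let K : Matrix (Fin N) (Fin N) ℂ := (imaginaryPart A : Matrix (Fin N) (Fin N) ℂ)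
  have hH : H.IsHermitian := (realPart A).2
  have hK : K.IsHermitian := (imaginaryPart A).2
  have hAe : A = H + Complex.I • K := (realPart_add_I_smul_imaginaryPart A).symm
  ext φ ψ
  let L : Fin N → Fin N → Polynomial ℂ := fun a b =>
    Polynomial.C (H a b) + Polynomial.C (K a b) * Polynomial.X
  let P : Polynomial ℂ := (∑ χ, Polynomial.C (M φ χ) * ∏ j, L (χ j) (ψ j))
    - ∑ χ, (∏ j, L (φ j) (χ j)) * Polynomial.C (M χ ψ)
  have hP : ∀ z : ℂ, P.eval z =
      (M * wgT k (H + z • K)) φ ψ - (wgT k (H + z • K) * M) φ ψ := by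
    intro z
    simp [P, L, Matrix.mul_apply, wgT, Polynomial.eval_finsetSum, Polynomial.eval_prod,
      mul_comm z]
  have h0 : P = 0 := by
    apply Polynomial.eq_zero_of_infinite_isRoot
    refine Set.Infinite.mono ?_ (Set.infinite_range_of_injective Complex.ofReal_injective)
    rintro _ ⟨t, rfl⟩
    have hh : (H + (t : ℂ) • K).IsHermitian := by
      refine hH.add ?_
      rw [Matrix.IsHermitian, Matrix.conjTranspose_smul, hK.eq]
      simp
    show P.eval _ = 0
    rw [hP, wg_comm_herm M hM _ hh, sub_self]
  have := hP Complex.I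
  rw [h0, ← hAe] at this
  rw [Polynomial.eval_zero] at this
  exact sub_eq_zero.1 this.symm

lemma wg_gram {k N : ℕ} (ρ σ : Perm (Fin k)) :
    ∑ f : Fin k → Fin N, (if ∀ j, f (ρ j) = f (σ j) then (1 : ℂ) else 0)
      = (N : ℂ) ^ cycleCount (ρ * σ⁻¹) := by
  classical
  rw [Finset.sum_boole, ← Nat.cast_pow, ← wg_card_fixed, Fintype.card_subtype]
  congr 2
  ext f
  simp only [Finset.mem_filter, Finset.mem_univ, true_and, funext_iff, Function.comp_apply,
    Perm.mul_apply]
  constructor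
  · intro h j
    rw [h]; simp
  · intro h j
    have := h (σ j)
    simpa using this

lemma wg_iota_eq {k N : ℕ} (hkN : k ≤ N) (σ τ : Perm (Fin k)) :
    (∀ j, Fin.castLE hkN (σ j) = Fin.castLE hkN (τ j)) ↔ τ = σ := by
  constructor
  · intro h
    ext1 j
    exact (Fin.castLE_injective hkN (h j)).symm
  · rintro rfl j; rfl

/-- Schur-Weyl duality for `k ≤ N`. -/
lemma wg_schurWeyl {k N : ℕ} (hkN : k ≤ N) (M : Matrix (Fin k → Fin N) (Fin k → Fin N) ℂ)
    (hM : ∀ u ∈ Matrix.unitaryGroup (Fin N) ℂ, M * wgT k u = wgT k u * M) :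
    ∃ c : Perm (Fin k) → ℂ, ∀ φ φ', M φ φ' =
      ∑ σ, c σ * (if ∀ j, φ j = φ' (σ j) then (1 : ℂ) else 0) := by
  classical
  let ι : Fin k → Fin N := Fin.castLE hkN
  refine ⟨fun σ => M (ι ∘ σ) ι, ?_⟩
  have hcol : ∀ χ, M χ ι = ∑ σ : Perm (Fin k), M (ι ∘ σ) ι * (if χ = ι ∘ σ then (1 : ℂ) else 0) := by
    intro χ
    by_cases h0 : ∃ σ : Perm (Fin k), χ = ι ∘ σ
    · obtain ⟨τ, rfl⟩ := h0
      rw [Finset.sum_eq_single τ]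
      · simp
      · intro σ _ hne
        rw [if_neg, mul_zero]
        intro h
        exact hne ((wg_iota_eq hkN τ σ).1 (fun j => congrFun h j))
      · simp
    · rw [Finset.sum_eq_zero]
      · by_contra h
        exact h0 (wg_support M hM _ _ h)
      · intro σ _
        rw [if_neg (fun h => h0 ⟨σ, h⟩), mul_zero]
  intro φ φ'
  let A : Matrix (Fin N) (Fin N) ℂ := fun a b =>
    if h : (b : ℕ) < k then (if a = φ' ⟨b, h⟩ then 1 else 0) else 0
  have hA : ∀ a j, A a (ι j) = if a = φ' j then 1 else 0 := by
    intro a j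
    simp [A, ι]
  have key := congrFun (congrFun (wg_comm_all M hM A) φ) ι
  have hT : ∀ (χ : Fin k → Fin N) (σ : Perm (Fin k)), wgT k A χ (ι ∘ σ) =
      if ∀ j, χ j = φ' (σ j) then 1 else 0 := by
    intro χ σ
    simp only [wgT, Function.comp_apply, hA, Finset.prod_boole, Finset.mem_univ, true_imp_iff]
  have hT1 : ∀ χ : Fin k → Fin N, wgT k A χ ι = if χ = φ' then 1 else 0 := by
    intro χ
    have h : wgT k A χ ι = _ := hT χ 1
    rw [h]
    exact if_congr funext_iff.symm rfl rfl
  rw [Matrix.mul_apply, Matrix.mul_apply] at key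
  simp only [hT1] at key
  rw [Finset.sum_eq_single φ' (by intro b _ hb; simp [hb]) (by simp)] at key
  rw [if_pos rfl, mul_one] at key
  rw [key]
  calc ∑ χ, wgT k A φ χ * M χ ι
      = ∑ χ, ∑ σ : Perm (Fin k), wgT k A φ χ *
          (M (ι ∘ σ) ι * (if χ = ι ∘ σ then (1 : ℂ) else 0)) := by
        refine Finset.sum_congr rfl fun χ _ => ?_
        conv_lhs => rw [hcol χ]
        rw [Finset.mul_sum]
    _ = ∑ σ : Perm (Fin k), M (ι ∘ σ) ι * wgT k A φ (ι ∘ σ) := by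
        rw [Finset.sum_comm]
        refine Finset.sum_congr rfl fun σ _ => ?_
        rw [Finset.sum_eq_single (ι ∘ σ) (by intro b _ hb; simp [hb]) (by simp)]
        simp [mul_comm]
    _ = _ := by simp only [hT]

lemma wg_gram_inj {k N : ℕ} (hkN : k ≤ N) (f : Perm (Fin k) → ℂ)
    (hf : ∀ σ, ∑ ρ, (N : ℂ) ^ cycleCount (σ * ρ⁻¹) * f ρ = 0) : f = 0 := by
  classical
  let B : (Fin k → Fin N) → (Fin k → Fin N) → ℂ := fun φ φ' =>
    ∑ σ, f σ * (if ∀ j, φ j = φ' (σ j) then (1 : ℂ) else 0)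
  have h1 : ∑ φ', ∑ φ, (starRingEnd ℂ) (B φ φ') * B φ φ' = 0 := by
    have e1 : ∀ φ', ∑ φ, (starRingEnd ℂ) (B φ φ') * B φ φ' =
        ∑ σ, (starRingEnd ℂ) (f σ) * B (φ' ∘ σ) φ' := by
      intro φ'
      calc ∑ φ, (starRingEnd ℂ) (B φ φ') * B φ φ'
          = ∑ φ, ∑ σ : Perm (Fin k), ((starRingEnd ℂ) (f σ) * if φ = φ' ∘ σ then 1 else 0)
              * B φ φ' := by
            refine Finset.sum_congr rfl fun φ _ => ?_
            rw [← Finset.sum_mul]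
            congr 1
            simp only [B, map_sum, map_mul, apply_ite (starRingEnd ℂ), map_one, map_zero,
              funext_iff, Function.comp_apply]
        _ = _ := by
            rw [Finset.sum_comm]
            refine Finset.sum_congr rfl fun σ _ => ?_
            rw [Finset.sum_eq_single (φ' ∘ σ) (by intro b _ hb; simp [hb]) (by simp)]
            simp
    simp only [e1]
    rw [Finset.sum_comm]
    refine Finset.sum_eq_zero fun σ _ => ?_
    rw [← Finset.mul_sum]
    have : ∑ φ' : Fin k → Fin N, B (φ' ∘ σ) φ' = 0 := by
      rw [← hf σ]
      simp only [B]
      rw [Finset.sum_comm]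
      refine Finset.sum_congr rfl fun ρ _ => ?_
      rw [← Finset.mul_sum, ← wg_gram, mul_comm]
      rfl
    rw [this, mul_zero]
  have h2 : ∀ φ φ', B φ φ' = 0 := by
    have e : ∑ φ', ∑ φ, Complex.normSq (B φ φ') = 0 := by
      have := h1
      simp only [← Complex.normSq_eq_conj_mul_self] at this
      exact_mod_cast this
    intro φ φ'
    rw [Finset.sum_eq_zero_iff_of_nonneg
      (fun _ _ => Finset.sum_nonneg fun _ _ => Complex.normSq_nonneg _)] at e
    have e' := e φ' (Finset.mem_univ _)
    rw [Finset.sum_eq_zero_iff_of_nonneg (fun _ _ => Complex.normSq_nonneg _)] at e'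
    exact Complex.normSq_eq_zero.1 (e' φ (Finset.mem_univ _))
  funext σ
  have h3 := h2 (fun j => Fin.castLE hkN (σ j)) (Fin.castLE hkN)
  simp only [B] at h3
  rw [Finset.sum_eq_single σ] at h3
  · simpa using h3
  · intro τ _ hne
    rw [if_neg (fun h => hne ((wg_iota_eq hkN σ τ).1 h)), mul_zero]
  · simp

lemma wg_conv_reindex {k N : ℕ} (f : Perm (Fin k) → ℂ) (σ : Perm (Fin k)) :
    ∑ τ, (N : ℂ) ^ cycleCount τ * f (τ⁻¹ * σ) =
      ∑ ρ, (N : ℂ) ^ cycleCount (σ * ρ⁻¹) * f ρ := by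
  refine Fintype.sum_equiv ((Equiv.inv _).trans (Equiv.mulRight σ)) _ _ fun τ => ?_
  simp

lemma wg_exists {k N : ℕ} (hkN : k ≤ N) : ∃ wg : Perm (Fin k) → ℂ,
    ∀ σ, ∑ ρ, (N : ℂ) ^ cycleCount (σ * ρ⁻¹) * wg ρ = if σ = 1 then 1 else 0 := by
  classical
  let L : (Perm (Fin k) → ℂ) →ₗ[ℂ] (Perm (Fin k) → ℂ) :=
    Matrix.toLin' (fun σ ρ => (N : ℂ) ^ cycleCount (σ * ρ⁻¹))
  have hL : ∀ f σ, L f σ = ∑ ρ, (N : ℂ) ^ cycleCount (σ * ρ⁻¹) * f ρ := by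
    intro f σ; rfl
  have hinj : Function.Injective L := by
    rw [injective_iff_map_eq_zero]
    intro f hf
    exact wg_gram_inj hkN f fun σ => by rw [← hL, hf]; rfl
  obtain ⟨wg, h⟩ := (LinearMap.injective_iff_surjective.1 hinj) (fun σ => if σ = 1 then 1 else 0)
  exact ⟨wg, fun σ => by rw [← hL, h]⟩

/-- Solution of the Gram system through the Weingarten function. -/
lemma wg_solve {k N : ℕ} (hkN : k ≤ N) (wg c d : Perm (Fin k) → ℂ)
    (hwg : ∀ σ, ∑ ρ, (N : ℂ) ^ cycleCount (σ * ρ⁻¹) * wg ρ = if σ = 1 then 1 else 0)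
    (hc : ∀ ρ, ∑ σ, (N : ℂ) ^ cycleCount (ρ * σ⁻¹) * c σ = d ρ) (σ : Perm (Fin k)) :
    c σ = ∑ τ, d τ * wg (τ * σ⁻¹) := by
  classical
  have h2 : ∀ ρ, ∑ σ, (N : ℂ) ^ cycleCount (ρ * σ⁻¹) * (∑ τ, d τ * wg (τ * σ⁻¹)) = d ρ := by
    intro ρ
    calc _ = ∑ τ, d τ * ∑ σ, (N : ℂ) ^ cycleCount (ρ * σ⁻¹) * wg (τ * σ⁻¹) := by
          simp only [Finset.mul_sum]
          rw [Finset.sum_comm]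
          refine Finset.sum_congr rfl fun τ _ => Finset.sum_congr rfl fun σ _ => by ring
      _ = ∑ τ, d τ * (if τ * ρ⁻¹ = 1 then 1 else 0) := by
          refine Finset.sum_congr rfl fun τ _ => ?_
          rw [← hwg]
          congr 1
          refine Fintype.sum_equiv ((Equiv.inv _).trans (Equiv.mulLeft τ)) _ _ fun σ => ?_
          simp only [Equiv.trans_apply, Equiv.inv_apply, Equiv.coe_mulLeft]
          congr 2
          rw [← wg_cycleCount_inv, mul_assoc, wg_cycleCount_comm τ, _root_.mul_inv_rev, inv_inv,
            wg_cycleCount_comm σ]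
          congr 1
          group
      _ = d ρ := by
          simp [mul_inv_eq_one]
  have := wg_gram_inj hkN (fun σ => c σ - ∑ τ, d τ * wg (τ * σ⁻¹)) (fun σ => by
    simp only [mul_sub, Finset.sum_sub_distrib, hc, h2, sub_self])
  exact sub_eq_zero.1 (congrFun this σ)

lemma wg_measurable_entry {N : ℕ} (a b : Fin N) :
    Measurable (fun u : Matrix.unitaryGroup (Fin N) ℂ => (u : Matrix (Fin N) (Fin N) ℂ) a b) := by
  have h1 : Measurable (fun A : Matrix (Fin N) (Fin N) ℂ => A a b) :=
    (measurable_pi_apply b).comp (measurable_pi_apply (X := fun _ : Fin N => Fin N → ℂ) a)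
  exact h1.comp measurable_subtype_coe

lemma wg_measurable_T {k N : ℕ} (φ ψ : Fin k → Fin N) :
    Measurable (fun u : Matrix.unitaryGroup (Fin N) ℂ =>
      wgT k (u : Matrix (Fin N) (Fin N) ℂ) φ ψ) := by
  unfold wgT
  exact Finset.measurable_prod _ fun j _ => wg_measurable_entry _ _

lemma wg_norm_T {k N : ℕ} (φ ψ : Fin k → Fin N) (u : Matrix.unitaryGroup (Fin N) ℂ) :
    ‖wgT k (u : Matrix (Fin N) (Fin N) ℂ) φ ψ‖ ≤ 1 := by
  unfold wgT
  rw [norm_prod]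
  exact Finset.prod_le_one (fun _ _ => norm_nonneg _)
    fun j _ => entry_norm_bound_of_unitary u.2 _ _

lemma wg_measurable_mul {N : ℕ} (g : Matrix.unitaryGroup (Fin N) ℂ) :
    Measurable (fun u : Matrix.unitaryGroup (Fin N) ℂ => g * u) := by
  refine Measurable.subtype_mk ?_
  refine measurable_pi_iff.2 fun a => measurable_pi_iff.2 fun b => ?_
  show Measurable fun u : Matrix.unitaryGroup (Fin N) ℂ =>
    ((g : Matrix (Fin N) (Fin N) ℂ) * (u : Matrix (Fin N) (Fin N) ℂ)) a b
  simp only [Matrix.mul_apply]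
  exact Finset.measurable_sum _ fun j _ => (wg_measurable_entry _ _).const_mul _

/-- The integrand. -/
def wgF {k N : ℕ} (φ ψ φ' ψ' : Fin k → Fin N) (u : Matrix.unitaryGroup (Fin N) ℂ) : ℂ :=
  wgT k (u : Matrix (Fin N) (Fin N) ℂ) φ ψ *
    (starRingEnd ℂ) (wgT k (u : Matrix (Fin N) (Fin N) ℂ) φ' ψ')

lemma wgF_measurable {k N : ℕ} (φ ψ φ' ψ' : Fin k → Fin N) : Measurable (wgF φ ψ φ' ψ') :=
  (wg_measurable_T _ _).mul (Complex.continuous_conj.measurable.comp (wg_measurable_T _ _))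

lemma wgF_integrable {k N : ℕ} (φ ψ φ' ψ' : Fin k → Fin N)
    (μ : Measure (Matrix.unitaryGroup (Fin N) ℂ)) [IsProbabilityMeasure μ] :
    Integrable (wgF φ ψ φ' ψ') μ := by
  refine Integrable.of_bound (wgF_measurable _ _ _ _).aestronglyMeasurable 1 ?_
  refine Filter.Eventually.of_forall fun u => ?_
  rw [wgF, norm_mul, RCLike.norm_conj]
  exact mul_le_one₀ (wg_norm_T _ _ _) (norm_nonneg _) (wg_norm_T _ _ _)

lemma wg_int_comm {k N : ℕ} (ψ ψ' : Fin k → Fin N)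
    (μ : Measure (Matrix.unitaryGroup (Fin N) ℂ)) [IsProbabilityMeasure μ]
    (hinv : μ.IsMulLeftInvariant)
    (M : Matrix (Fin k → Fin N) (Fin k → Fin N) ℂ)
    (hMd : ∀ φ φ', M φ φ' = ∫ u, wgF φ ψ φ' ψ' u ∂μ)
    (g : Matrix (Fin N) (Fin N) ℂ) (hg : g ∈ Matrix.unitaryGroup (Fin N) ℂ) :
    M * wgT k g = wgT k g * M := by
  have h1 : M = wgT k g * M * (wgT k g)ᴴ := by
    ext φ φ'
    have e1 : M φ φ' = ∫ u, wgF φ ψ φ' ψ' (⟨g, hg⟩ * u) ∂μ := by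
      rw [hMd]
      conv_lhs => rw [← hinv.map_mul_left_eq_self ⟨g, hg⟩]
      exact integral_map (wg_measurable_mul _).aemeasurable
        (wgF_measurable _ _ _ _).aestronglyMeasurable
    have e2 : ∀ u, wgF φ ψ φ' ψ' (⟨g, hg⟩ * u) =
        ∑ χ', ∑ χ, (wgT k g φ χ * (starRingEnd ℂ) (wgT k g φ' χ')) * wgF χ ψ χ' ψ' u := by
      intro u
      have e3 : ∀ φ ψ : Fin k → Fin N,
          wgT k ((⟨g, hg⟩ * u : Matrix.unitaryGroup (Fin N) ℂ) : Matrix (Fin N) (Fin N) ℂ) φ ψ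
          = ∑ χ, wgT k g φ χ * wgT k (u : Matrix (Fin N) (Fin N) ℂ) χ ψ := by
        intro φ ψ
        rw [← Matrix.mul_apply, ← wgT_mul]
        rfl
      simp only [wgF, e3, map_sum, map_mul]
      rw [Finset.sum_mul_sum, Finset.sum_comm]
      refine Finset.sum_congr rfl fun χ _ => Finset.sum_congr rfl fun χ' _ => by ring
    rw [e1]
    simp only [e2]
    rw [integral_finsetSum _ (fun χ' _ => integrable_finsetSum _ fun χ _ =>
      (wgF_integrable _ _ _ _ μ).const_mul _)]
    rw [Matrix.mul_apply]
    refine Finset.sum_congr rfl fun χ' _ => ?_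
    rw [integral_finsetSum _ (fun χ _ => (wgF_integrable _ _ _ _ μ).const_mul _)]
    rw [Matrix.mul_apply, Finset.sum_mul]
    refine Finset.sum_congr rfl fun χ _ => ?_
    rw [integral_const_mul, ← hMd, Matrix.conjTranspose_apply]
    simp only [RCLike.star_def]
    ring
  have h2 : (wgT k g)ᴴ * wgT k g = 1 := by
    rw [← wgT_conjTranspose, ← wgT_mul, ← wgT_one]
    congr 1
    exact Matrix.mem_unitaryGroup_iff'.1 hg
  calc M * wgT k g = wgT k g * M * (wgT k g)ᴴ * wgT k g := by rw [← h1]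
    _ = wgT k g * M := by rw [Matrix.mul_assoc, h2, Matrix.mul_one]

lemma wg_contract {k N : ℕ} (ψ ψ' : Fin k → Fin N) (ρ : Perm (Fin k))
    (u : Matrix.unitaryGroup (Fin N) ℂ) :
    ∑ f : Fin k → Fin N, wgF (f ∘ ρ) ψ f ψ' u =
      if ∀ j, ψ j = ψ' (ρ j) then (1 : ℂ) else 0 := by
  have h1 : ∀ f : Fin k → Fin N, wgF (f ∘ ρ) ψ f ψ' u =
      (fun χ : Fin k → Fin N => ∏ j, ((u : Matrix (Fin N) (Fin N) ℂ) (χ j) (ψ j) *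
        (starRingEnd ℂ) ((u : Matrix (Fin N) (Fin N) ℂ) (χ j) (ψ' (ρ j))))) (f ∘ ρ) := by
    intro f
    simp only [wgF, wgT, Finset.prod_mul_distrib, map_prod, Function.comp_apply]
    congr 1
    exact (Equiv.prod_comp ρ (fun j =>
      (starRingEnd ℂ) ((u : Matrix (Fin N) (Fin N) ℂ) (f j) (ψ' j)))).symm
  rw [Fintype.sum_equiv (Equiv.arrowCongr ρ.symm (Equiv.refl (Fin N)))
    (fun f => wgF (f ∘ ρ) ψ f ψ' u) (fun χ : Fin k → Fin N => ∏ j, ((u : Matrix (Fin N) (Fin N) ℂ) (χ j) (ψ j) *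
        (starRingEnd ℂ) ((u : Matrix (Fin N) (Fin N) ℂ) (χ j) (ψ' (ρ j))))) (fun f => h1 f)]
  rw [← Fintype.prod_sum (fun j a => (u : Matrix (Fin N) (Fin N) ℂ) a (ψ j) *
        (starRingEnd ℂ) ((u : Matrix (Fin N) (Fin N) ℂ) a (ψ' (ρ j))))]
  have h2 : ∀ a b, ∑ c, (u : Matrix (Fin N) (Fin N) ℂ) c a *
      (starRingEnd ℂ) ((u : Matrix (Fin N) (Fin N) ℂ) c b) = if a = b then 1 else 0 := by
    intro a b
    have := congrFun (congrFun (Matrix.mem_unitaryGroup_iff'.1 u.2) b) a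
    rw [Matrix.mul_apply, Matrix.one_apply] at this
    simp only [eq_comm (a := a)]
    rw [← this]
    refine Finset.sum_congr rfl fun c _ => ?_
    rw [Matrix.star_apply, mul_comm]
    rfl
  simp only [h2, Finset.prod_boole, Finset.mem_univ, true_imp_iff]

end Helpers

/-- The unitary Weingarten integration formula: the function
`σ ↦ N^{#cycles σ}` on `S_k` has a convolution inverse `Wg` (for `N ≥ k`), and
the Haar integral of `∏ⱼ u_{φ(j) ψ(j)} conj(u_{φ'(j) ψ'(j)})` over `U(N)` equals
`∑_{σ,τ} 1[φ = φ'∘σ] 1[ψ = ψ'∘τ] Wg(τσ⁻¹)`. -/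
theorem weingarten_unitary
    (k N : ℕ) (hkN : k ≤ N)
    (φ ψ φ' ψ' : Fin k → Fin N)
    (μ : Measure (Matrix.unitaryGroup (Fin N) ℂ))
    (hprob : IsProbabilityMeasure μ) (hinv : μ.IsMulLeftInvariant) :
    ∃ wg : Equiv.Perm (Fin k) → ℂ,
      (∀ σ : Equiv.Perm (Fin k),
        ∑ τ : Equiv.Perm (Fin k), (N : ℂ) ^ cycleCount τ * wg (τ⁻¹ * σ)
          = if σ = 1 then 1 else 0) ∧
      (∫ u, ∏ j, (u : Matrix (Fin N) (Fin N) ℂ) (φ j) (ψ j)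
          * (starRingEnd ℂ) ((u : Matrix (Fin N) (Fin N) ℂ) (φ' j) (ψ' j)) ∂ μ)
        = ∑ σ : Equiv.Perm (Fin k), ∑ τ : Equiv.Perm (Fin k),
            (if ∀ j, φ j = φ' (σ j) then (1 : ℂ) else 0) *
            (if ∀ j, ψ j = ψ' (τ j) then (1 : ℂ) else 0) *
            wg (τ * σ⁻¹) := by
  classical
  obtain ⟨wg, hwg⟩ := wg_exists hkN
  refine ⟨wg, fun σ => by rw [wg_conv_reindex]; exact hwg σ, ?_⟩
  let M : Matrix (Fin k → Fin N) (Fin k → Fin N) ℂ := fun φ φ' => ∫ u, wgF φ ψ φ' ψ' u ∂μ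
  obtain ⟨c, hc⟩ := wg_schurWeyl hkN M
    (fun g hg => wg_int_comm ψ ψ' μ hinv M (fun _ _ => rfl) g hg)
  have hd : ∀ ρ : Equiv.Perm (Fin k), ∑ σ, (N : ℂ) ^ cycleCount (ρ * σ⁻¹) * c σ =
      if ∀ j, ψ j = ψ' (ρ j) then (1 : ℂ) else 0 := by
    intro ρ
    have e1 : ∑ f : Fin k → Fin N, M (f ∘ ρ) f =
        if ∀ j, ψ j = ψ' (ρ j) then (1 : ℂ) else 0 := by
      simp only [M]
      rw [← integral_finsetSum _ (fun f _ => wgF_integrable _ _ _ _ μ)]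
      simp only [wg_contract]
      simp
    rw [← e1]
    simp only [hc]
    rw [Finset.sum_comm]
    refine Finset.sum_congr rfl fun σ _ => ?_
    rw [← Finset.mul_sum, ← wg_gram, mul_comm]
    rfl
  have hM : (∫ u, ∏ j, (u : Matrix (Fin N) (Fin N) ℂ) (φ j) (ψ j)
      * (starRingEnd ℂ) ((u : Matrix (Fin N) (Fin N) ℂ) (φ' j) (ψ' j)) ∂ μ) = M φ φ' := by
    simp only [M, wgF, wgT, Finset.prod_mul_distrib, map_prod]
  rw [hM, hc]
  refine Finset.sum_congr rfl fun σ _ => ?_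
  rw [wg_solve hkN wg c _ hwg hd σ, Finset.sum_mul]
  refine Finset.sum_congr rfl fun τ _ => ?_
  ring
end
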